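/- (c) For σ ∈ {+, −}, the quotient ring R_σ := Ω/I_σ is an integral domain. (d) The ideals satisfy I₀ = I₊ ∩ I₋ in Ω. -/

import Mathlib

noncomputable section

/-!
The ring `Ω = ℤ[q^{±1}, λ^{±1}, q₀^{±1}, q₁, …, q_{k-1}, A₀, …, A_{k-1}]`, presented as a
polynomial ring (with explicit inverse variables) modulo the invertibility relations, and
the elements `β, h_l, h_l'` of the admissibility theory of cyclotomic BMW algebras.
-/

namespace CycloAdm

/-- The variables of `Ω`: `q, q⁻¹, λ, λ⁻¹, q₀, q₀⁻¹`, the `q_j` (`1 ≤ j ≤ k-1`, encoded by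
`Fin (k-1)` with `qc t = q_{t+1}`) and the `A_j` (`0 ≤ j ≤ k-1`). -/
inductive OVar (k : ℕ) : Type
  | q : OVar k
  | qi : OVar k
  | lam : OVar k
  | lami : OVar k
  | q0 : OVar k
  | q0i : OVar k
  | qc : Fin (k - 1) → OVar k
  | A : Fin k → OVar k

abbrev OmegaP (k : ℕ) := MvPolynomial (OVar k) ℤ

/-- The invertibility relations `q q⁻¹ = 1`, `λ λ⁻¹ = 1`, `q₀ q₀⁻¹ = 1`. -/
def OmegaI (k : ℕ) : Ideal (OmegaP k) :=
  Ideal.span ({MvPolynomial.X OVar.q * MvPolynomial.X OVar.qi - 1,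
    MvPolynomial.X OVar.lam * MvPolynomial.X OVar.lami - 1,
    MvPolynomial.X OVar.q0 * MvPolynomial.X OVar.q0i - 1} : Set (OmegaP k))

/-- The ring `Ω`. -/
abbrev Omega (k : ℕ) := OmegaP k ⧸ OmegaI k

def mkO (k : ℕ) : OmegaP k →+* Omega k := Ideal.Quotient.mk (OmegaI k)

def vq (k : ℕ) : Omega k := mkO k (MvPolynomial.X OVar.q)
def vqi (k : ℕ) : Omega k := mkO k (MvPolynomial.X OVar.qi)
def vlam (k : ℕ) : Omega k := mkO k (MvPolynomial.X OVar.lam)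
def vlami (k : ℕ) : Omega k := mkO k (MvPolynomial.X OVar.lami)
def vq0 (k : ℕ) : Omega k := mkO k (MvPolynomial.X OVar.q0)
def vq0i (k : ℕ) : Omega k := mkO k (MvPolynomial.X OVar.q0i)

/-- The variable `q_j` for `1 ≤ j ≤ k-1` (and `0` out of range). -/
def vqc (k : ℕ) (j : ℕ) : Omega k :=
  if h : 1 ≤ j ∧ j ≤ k - 1 then
    mkO k (MvPolynomial.X (OVar.qc ⟨j - 1, by omega⟩)) else 0

/-- The variable `A_j` for `0 ≤ j ≤ k-1` (and `0` out of range). -/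
def vA (k : ℕ) (j : ℕ) : Omega k :=
  if h : j < k then mkO k (MvPolynomial.X (OVar.A ⟨j, h⟩)) else 0

/-- `q_j ∈ Ω` for `0 ≤ j ≤ k`, with the conventions `q_0 := q₀` and `q_k := -1`. -/
def Qcv (k : ℕ) (j : ℕ) : Omega k :=
  if j = 0 then vq0 k else if j = k then -1 else vqc k j

/-- `β = q₀λ - q₀⁻¹λ⁻¹ + (1-ε)δ` where `k = 2z - ε`, `z = ⌈k/2⌉`, `δ = q - q⁻¹`. -/
def betaElt {T : Type} [CommRing T] (k : ℕ) (q qi lam lami q0 q0i : T) : T :=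
  q0 * lam - q0i * lami + ((1 - (2 * ((k + 1) / 2) - k) : ℕ) : T) * (q - qi)

/-- `h_l` for `0 ≤ l ≤ k-1` (with `h₀ = λ - λ⁻¹ + δ(A₀ - 1)`). -/
def hElt {T : Type} [CommRing T] (k : ℕ) (q qi lam lami q0i : T) (Qc Av : ℕ → T)
    (l : ℕ) : T :=
  if l = 0 then lam - lami + (q - qi) * (Av 0 - 1)
  else
    lami * (Qc l + q0i * Qc (k - l)) +
      (q - qi) * ((∑ r ∈ Finset.Icc 1 (k - l), Qc (r + l) * Av r)
        - (∑ i ∈ Finset.Icc (max (l + 1) ((k + 1) / 2)) ((l + k) / 2), Qc (2 * i - l))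
        + (∑ i ∈ Finset.Icc ((l + 1) / 2) (min l ((k + 1) / 2 - 1)), Qc (2 * i - l)))

/-- `h_l'` for `1 ≤ l ≤ k-1`. -/
def h'Elt {T : Type} [CommRing T] (k : ℕ) (q0i : T) (Qc Av : ℕ → T) (l : ℕ) : T :=
  (∑ r ∈ Finset.Icc 1 l, q0i * Qc (r + (k - l)) * Av r)
    - (∑ r ∈ Finset.Icc 0 (k - l), Qc (r + l) * Av r)
    - (∑ i ∈ Finset.Icc ((l + 1) / 2) (l - 1), (q0i * Qc (k + l - 2 * i) + Qc (2 * i - l)))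
    + (∑ i ∈ Finset.Icc ((k + 1) / 2) ((l + k) / 2), (q0i * Qc (k + l - 2 * i) + Qc (2 * i - l)))

/-- `β ∈ Ω`. -/
def betaO (k : ℕ) : Omega k :=
  betaElt k (vq k) (vqi k) (vlam k) (vlami k) (vq0 k) (vq0i k)

/-- `h_l ∈ Ω`. -/
def hO (k : ℕ) (l : ℕ) : Omega k :=
  hElt k (vq k) (vqi k) (vlam k) (vlami k) (vq0i k) (Qcv k) (vA k) l

/-- `h_l' ∈ Ω`. -/
def h'O (k : ℕ) (l : ℕ) : Omega k := h'Elt k (vq0i k) (Qcv k) (vA k) l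

/-- `β₊`. -/
def betaPl (k : ℕ) : Omega k :=
  if k % 2 = 1 then vq0 k * vlam k - 1 else vq0 k * vlam k - vqi k

/-- `β₋`. -/
def betaMi (k : ℕ) : Omega k :=
  if k % 2 = 1 then vq0i k * vlami k + 1 else vq k * vq0i k * vlami k + 1

/-- The ideal `I_σ = ⟨β_σ, h₀, h₁, …, h_{z-ε}, h₁', …, h_{z-ε}'⟩` of `Ω`
(note `z - ε = ⌊k/2⌋`). -/
def Isig (k : ℕ) (bs : Omega k) : Ideal (Omega k) :=
  Ideal.span ({bs, hO k 0} ∪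
    {x | ∃ l, 1 ≤ l ∧ l ≤ k / 2 ∧ (x = hO k l ∨ x = h'O k l)})

end CycloAdm

end

open CycloAdm

section Identities

variable {T : Type} [CommRing T]

/-- The part of `h_l + δ h_l' + q_l h₀` not involving `q_{k-l}`. -/
def gTail (k : ℕ) (q qi lam q0i : T) (Qc Av : ℕ → T) (l : ℕ) : T :=
  lam * Qc l + (q - qi) * q0i *
    ((∑ r ∈ Finset.Icc 1 l, Qc (r + (k - l)) * Av r)
      - (∑ i ∈ Finset.Icc ((l + 1) / 2) (l - 1), Qc (k + l - 2 * i))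
      + (∑ i ∈ Finset.Icc ((k + 1) / 2) ((l + k) / 2), Qc (k + l - 2 * i)))

/-- The part of `h_l'` not involving `A_{k-l}`. -/
def h'Tail (k : ℕ) (q0i : T) (Qc Av : ℕ → T) (l : ℕ) : T :=
  (∑ r ∈ Finset.Icc 1 l, q0i * Qc (r + (k - l)) * Av r)
    - (∑ r ∈ Finset.Ico 0 (k - l), Qc (r + l) * Av r)
    - (∑ i ∈ Finset.Icc ((l + 1) / 2) (l - 1), (q0i * Qc (k + l - 2 * i) + Qc (2 * i - l)))
    + (∑ i ∈ Finset.Icc ((k + 1) / 2) ((l + k) / 2), (q0i * Qc (k + l - 2 * i) + Qc (2 * i - l)))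

/-- For `k = 2z`, the coefficient of `δ` in `h_z` without its term `-A_z`. -/
def midTail (k : ℕ) (Qc Av : ℕ → T) : T :=
  (∑ r ∈ Finset.Ico 1 (k / 2), Qc (r + k / 2) * Av r)
    - (∑ i ∈ Finset.Icc (k / 2 + 1) ((k / 2 + k) / 2), Qc (2 * i - k / 2))
    + (∑ i ∈ Finset.Ico ((k / 2 + 1) / 2) (k / 2), Qc (2 * i - k / 2))

theorem hElt_add_h'Elt (k : ℕ) (q qi lam lami q0i : T) (Qc Av : ℕ → T) {l : ℕ} (hl : 1 ≤ l)
    (hlk : 2 * l < k) :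
    hElt k q qi lam lami q0i Qc Av l + (q - qi) * h'Elt k q0i Qc Av l
        + Qc l * hElt k q qi lam lami q0i Qc Av 0
      = lami * q0i * Qc (k - l) + gTail k q qi lam q0i Qc Av l := by
  have h1 : max (l + 1) ((k + 1) / 2) = (k + 1) / 2 := by omega
  have h2 : min l ((k + 1) / 2 - 1) = l := by omega
  have h3 : ∑ r ∈ Finset.Icc 0 (k - l), Qc (r + l) * Av r
      = Qc l * Av 0 + ∑ r ∈ Finset.Icc 1 (k - l), Qc (r + l) * Av r := by
    rw [← Finset.add_sum_Ioc_eq_sum_Icc (Nat.zero_le _), zero_add]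
    rfl
  have h4 : ∑ i ∈ Finset.Icc ((l + 1) / 2) l, Qc (2 * i - l)
      = (∑ i ∈ Finset.Icc ((l + 1) / 2) (l - 1), Qc (2 * i - l)) + Qc l := by
    obtain ⟨j, rfl⟩ : ∃ j, l = j + 1 := ⟨l - 1, by omega⟩
    rw [Finset.sum_Icc_succ_top (by omega)]
    congr 2
    omega
  have h5 : ∑ r ∈ Finset.Icc 1 l, q0i * Qc (r + (k - l)) * Av r
      = q0i * ∑ r ∈ Finset.Icc 1 l, Qc (r + (k - l)) * Av r := by
    rw [Finset.mul_sum]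
    exact Finset.sum_congr rfl fun _ _ => mul_assoc _ _ _
  simp only [hElt, h'Elt, gTail, if_neg (show l ≠ 0 by omega), if_true, h1, h2, h3, h4, h5,
    Finset.sum_add_distrib, ← Finset.mul_sum]
  ring

theorem h'Elt_eq (k : ℕ) (q0i : T) (Qc Av : ℕ → T) (hQ : Qc k = -1) {l : ℕ} (hlk : l ≤ k) :
    h'Elt k q0i Qc Av l = Av (k - l) + h'Tail k q0i Qc Av l := by
  have h : ∑ r ∈ Finset.Icc 0 (k - l), Qc (r + l) * Av r
      = (∑ r ∈ Finset.Ico 0 (k - l), Qc (r + l) * Av r) - Av (k - l) := by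
    rw [← Finset.sum_Ico_add_eq_sum_Icc (Nat.zero_le _), Nat.sub_add_cancel hlk, hQ]
    ring
  rw [h'Elt, h'Tail, h]
  ring

theorem hElt_mid {k : ℕ} (hk : 1 ≤ k) (he : k % 2 = 0) (q qi lam lami q0i : T) (Qc Av : ℕ → T)
    (hQ : Qc k = -1) :
    hElt k q qi lam lami q0i Qc Av (k / 2) =
      lami * (1 + q0i) * Qc (k / 2) + (q - qi) * (midTail k Qc Av - Av (k / 2)) := by
  obtain ⟨z, rfl⟩ : ∃ z, k = 2 * z := ⟨k / 2, by omega⟩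
  have h0 : 2 * z / 2 = z := by omega
  have h1 : max (z + 1) ((2 * z + 1) / 2) = z + 1 := by omega
  have h2 : min z ((2 * z + 1) / 2 - 1) = z - 1 := by omega
  have h3 : 2 * z - z = z := by omega
  have h4 : Finset.Icc ((z + 1) / 2) (z - 1) = Finset.Ico ((z + 1) / 2) z := by
    ext; simp only [Finset.mem_Icc, Finset.mem_Ico]; omega
  have h5 : ∑ r ∈ Finset.Icc 1 z, Qc (r + z) * Av r
      = (∑ r ∈ Finset.Ico 1 z, Qc (r + z) * Av r) - Av z := by
    rw [← Finset.sum_Ico_add_eq_sum_Icc (by omega), ← two_mul, hQ]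
    ring
  simp only [hElt, midTail, h0, if_neg (show z ≠ 0 by omega), h1, h2, h3, h4, h5]
  ring

theorem h'Elt_mid {k : ℕ} (hk : 1 ≤ k) (he : k % 2 = 0) (q0i : T) (Qc Av : ℕ → T)
    (hQ : Qc k = -1) :
    h'Elt k q0i Qc Av (k / 2) =
      (q0i - 1) * (midTail k Qc Av - Av (k / 2)) - Qc (k / 2) * (Av 0 - 1 - q0i) := by
  obtain ⟨z, rfl⟩ : ∃ z, k = 2 * z := ⟨k / 2, by omega⟩
  have h0 : 2 * z / 2 = z := by omega
  have h1 : (2 * z + 1) / 2 = z := by omega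
  have h3 : 2 * z - z = z := by omega
  have h4 : Finset.Icc ((z + 1) / 2) (z - 1) = Finset.Ico ((z + 1) / 2) z := by
    ext; simp only [Finset.mem_Icc, Finset.mem_Ico]; omega
  have h5 : ∑ r ∈ Finset.Icc 1 z, Qc (r + z) * Av r
      = (∑ r ∈ Finset.Ico 1 z, Qc (r + z) * Av r) - Av z := by
    rw [← Finset.sum_Ico_add_eq_sum_Icc (by omega), ← two_mul, hQ]
    ring
  have h6 : ∑ r ∈ Finset.Icc 0 z, Qc (r + z) * Av r
      = Qc z * Av 0 + ∑ r ∈ Finset.Icc 1 z, Qc (r + z) * Av r := by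
    rw [← Finset.add_sum_Ioc_eq_sum_Icc (Nat.zero_le _), zero_add]
    rfl
  have h7 (F : ℕ → T) : ∑ i ∈ Finset.Icc z ((z + 2 * z) / 2), F i
      = F z + ∑ i ∈ Finset.Icc (z + 1) ((z + 2 * z) / 2), F i := by
    rw [← Finset.add_sum_Ioc_eq_sum_Icc (by omega)]
    refine congrArg₂ _ rfl (Finset.sum_congr ?_ fun _ _ => rfl)
    ext; simp only [Finset.mem_Icc, Finset.mem_Ioc]; omega
  have h8 : ∑ i ∈ Finset.Ico ((z + 1) / 2) z, Qc (2 * z + z - 2 * i)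
      = ∑ i ∈ Finset.Icc (z + 1) ((z + 2 * z) / 2), Qc (2 * i - z) := by
    refine Finset.sum_bij' (fun i _ => 2 * z - i) (fun i _ => 2 * z - i) ?_ ?_ ?_ ?_ ?_ <;>
      simp only [Finset.mem_Icc, Finset.mem_Ico] <;> intro i hi
    · omega
    · omega
    · omega
    · omega
    · congr 1; omega
  have h9 : ∑ i ∈ Finset.Icc (z + 1) ((z + 2 * z) / 2), Qc (2 * z + z - 2 * i)
      = ∑ i ∈ Finset.Ico ((z + 1) / 2) z, Qc (2 * i - z) := by
    refine Finset.sum_bij' (fun i _ => 2 * z - i) (fun i _ => 2 * z - i) ?_ ?_ ?_ ?_ ?_ <;>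
      simp only [Finset.mem_Icc, Finset.mem_Ico] <;> intro i hi
    · omega
    · omega
    · omega
    · omega
    · congr 1; omega
  have h10 : 2 * z + z - 2 * z = z := by omega
  simp only [h'Elt, midTail, h0, h1, h3, h4, mul_assoc, Finset.sum_add_distrib,
    ← Finset.mul_sum, h6, h7, h5, h8, h9, h10]
  ring

theorem map_hElt {T' : Type} [CommRing T'] (f : T →+* T') (k : ℕ) (q qi lam lami q0i : T)
    (Qc Av : ℕ → T) (l : ℕ) :
    f (hElt k q qi lam lami q0i Qc Av l) =
      hElt k (f q) (f qi) (f lam) (f lami) (f q0i) (fun j => f (Qc j)) (fun j => f (Av j)) l := by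
  unfold hElt
  split_ifs <;> simp [map_sum]

theorem map_h'Elt {T' : Type} [CommRing T'] (f : T →+* T') (k : ℕ) (q0i : T)
    (Qc Av : ℕ → T) (l : ℕ) :
    f (h'Elt k q0i Qc Av l) =
      h'Elt k (f q0i) (fun j => f (Qc j)) (fun j => f (Av j)) l := by
  simp [h'Elt, map_sum]

theorem gTail_mem (S : Subring T) {k : ℕ} {q qi lam q0i : T} {Qc Av : ℕ → T} {l : ℕ}
    (hl : 1 ≤ l) (hlk : 2 * l < k) (hq : q ∈ S) (hqi : qi ∈ S) (hlam : lam ∈ S) (hq0i : q0i ∈ S)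
    (hQ : ∀ j, j ≤ l → Qc j ∈ S) (hQ' : ∀ j, k - l < j → j ≤ k → Qc j ∈ S)
    (hA : ∀ j, 1 ≤ j → j ≤ l → Av j ∈ S) : gTail k q qi lam q0i Qc Av l ∈ S := by
  refine S.add_mem (S.mul_mem hlam (hQ _ le_rfl)) (S.mul_mem (S.mul_mem (S.sub_mem hq hqi) hq0i)
    (S.add_mem (S.sub_mem (S.sum_mem fun i hi => ?_) (S.sum_mem fun i hi => ?_))
      (S.sum_mem fun i hi => ?_))) <;> rw [Finset.mem_Icc] at hi
  · exact S.mul_mem (hQ' _ (by omega) (by omega)) (hA _ hi.1 hi.2)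
  · exact hQ' _ (by omega) (by omega)
  · exact hQ _ (by omega)

theorem h'Tail_mem (S : Subring T) {k : ℕ} {q0i : T} {Qc Av : ℕ → T} {l : ℕ}
    (hlk : 2 * l < k) (hq0i : q0i ∈ S) (hQ : ∀ j, Qc j ∈ S)
    (hA : ∀ j, j < k - l → Av j ∈ S) : h'Tail k q0i Qc Av l ∈ S := by
  refine S.add_mem (S.sub_mem (S.sub_mem (S.sum_mem fun i hi => ?_) (S.sum_mem fun i hi => ?_))
    (S.sum_mem fun i hi => ?_)) (S.sum_mem fun i hi => ?_)
  · rw [Finset.mem_Icc] at hi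
    exact S.mul_mem (S.mul_mem hq0i (hQ _)) (hA _ (by omega))
  · exact S.mul_mem (hQ _) (hA _ (Finset.mem_Ico.1 hi).2)
  · exact S.add_mem (S.mul_mem hq0i (hQ _)) (hQ _)
  · exact S.add_mem (S.mul_mem hq0i (hQ _)) (hQ _)

theorem midTail_mem (S : Subring T) {k : ℕ} {Qc Av : ℕ → T} (hQ : ∀ j, Qc j ∈ S)
    (hA : ∀ j, j < k / 2 → Av j ∈ S) : midTail k Qc Av ∈ S :=
  S.add_mem (S.sub_mem
    (S.sum_mem fun _ hi => S.mul_mem (hQ _) (hA _ (Finset.mem_Ico.1 hi).2))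
    (S.sum_mem fun _ _ => hQ _)) (S.sum_mem fun _ _ => hQ _)

theorem gTail_congr {k : ℕ} (q qi lam q0i : T) {Qc Qc' Av Av' : ℕ → T} {l : ℕ}
    (hl : 1 ≤ l) (hlk : 2 * l < k) (hQ : ∀ j, j ≤ l → Qc j = Qc' j)
    (hQ' : ∀ j, k - l < j → j ≤ k → Qc j = Qc' j)
    (hA : ∀ j, 1 ≤ j → j ≤ l → Av j = Av' j) :
    gTail k q qi lam q0i Qc Av l = gTail k q qi lam q0i Qc' Av' l := by
  have h1 : ∑ r ∈ Finset.Icc 1 l, Qc (r + (k - l)) * Av r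
      = ∑ r ∈ Finset.Icc 1 l, Qc' (r + (k - l)) * Av' r :=
    Finset.sum_congr rfl fun i hi => by
      rw [Finset.mem_Icc] at hi
      rw [hQ' _ (by omega) (by omega), hA _ hi.1 hi.2]
  have h2 : ∑ i ∈ Finset.Icc ((l + 1) / 2) (l - 1), Qc (k + l - 2 * i)
      = ∑ i ∈ Finset.Icc ((l + 1) / 2) (l - 1), Qc' (k + l - 2 * i) :=
    Finset.sum_congr rfl fun i hi => by
      rw [Finset.mem_Icc] at hi
      exact hQ' _ (by omega) (by omega)
  have h3 : ∑ i ∈ Finset.Icc ((k + 1) / 2) ((l + k) / 2), Qc (k + l - 2 * i)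
      = ∑ i ∈ Finset.Icc ((k + 1) / 2) ((l + k) / 2), Qc' (k + l - 2 * i) :=
    Finset.sum_congr rfl fun i hi => by
      rw [Finset.mem_Icc] at hi
      exact hQ _ (by omega)
  rw [gTail, gTail, h1, h2, h3, hQ _ le_rfl]

theorem h'Tail_congr {k : ℕ} (q0i : T) (Qc : ℕ → T) {Av Av' : ℕ → T} {l : ℕ}
    (hlk : 2 * l < k) (hA : ∀ j, j < k - l → Av j = Av' j) :
    h'Tail k q0i Qc Av l = h'Tail k q0i Qc Av' l := by
  have h1 : ∑ r ∈ Finset.Icc 1 l, q0i * Qc (r + (k - l)) * Av r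
      = ∑ r ∈ Finset.Icc 1 l, q0i * Qc (r + (k - l)) * Av' r :=
    Finset.sum_congr rfl fun i hi => by
      rw [Finset.mem_Icc] at hi
      rw [hA _ (by omega)]
  have h2 : ∑ r ∈ Finset.Ico 0 (k - l), Qc (r + l) * Av r
      = ∑ r ∈ Finset.Ico 0 (k - l), Qc (r + l) * Av' r :=
    Finset.sum_congr rfl fun i hi => by rw [hA _ (Finset.mem_Ico.1 hi).2]
  rw [h'Tail, h'Tail, h1, h2]

theorem midTail_congr {k : ℕ} (Qc : ℕ → T) {Av Av' : ℕ → T}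
    (hA : ∀ j, j < k / 2 → Av j = Av' j) : midTail k Qc Av = midTail k Qc Av' := by
  have h : ∑ r ∈ Finset.Ico 1 (k / 2), Qc (r + k / 2) * Av r
      = ∑ r ∈ Finset.Ico 1 (k / 2), Qc (r + k / 2) * Av' r :=
    Finset.sum_congr rfl fun i hi => by rw [hA _ (Finset.mem_Ico.1 hi).2]
  rw [midTail, midTail, h]

end Identities

section Solutions

variable {T : Type} [CommRing T]

theorem exists_recursive (F : ℕ → (ℕ → T) → T)
    (hF : ∀ n f g, (∀ j, j < n → f j = g j) → F n f = F n g) :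
    ∃ c : ℕ → T, ∀ n, c n = F n c := by
  let G : ∀ n, (∀ m, m < n → T) → T := fun n ih => F n fun j => if h : j < n then ih j h else 0
  refine ⟨Nat.lt_wfRel.wf.fix G, fun n => ?_⟩
  rw [WellFounded.fix_eq]
  exact hF _ _ _ fun j hj => dif_pos hj

theorem exists_solution {k : ℕ} (hk : 1 ≤ k) (q qi : T) {lam lami q0 q0i : T}
    (hlam : lam * lami = 1) (hq0 : q0 * q0i = 1) (sq sA : ℕ → T) (t : T) :
    ∃ Qc Av : ℕ → T, Qc 0 = q0 ∧ Qc k = -1 ∧ (∀ j, k < j → Qc j = 0) ∧ (∀ j, k ≤ j → Av j = 0) ∧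
      (∀ j, 1 ≤ j → j ≤ k / 2 → Qc j = sq j) ∧ (∀ j, j ≤ (k - 1) / 2 → Av j = sA j) ∧
      (k % 2 = 0 → midTail k Qc Av - Av (k / 2) = t) ∧
      ∀ l, 1 ≤ l → 2 * l < k → lami * q0i * Qc (k - l) + gTail k q qi lam q0i Qc Av l = 0 ∧
        Av (k - l) + h'Tail k q0i Qc Av l = 0 := by
  let Qf : (ℕ → T) → ℕ → T := fun c j =>
    if j = 0 then q0 else if j ≤ k / 2 then sq j else if j ≤ k then c (k - j) else 0
  obtain ⟨c, hc⟩ := exists_recursive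
    (fun n c => if n = 0 then -1 else
      if 2 * n < k then -(lam * q0 * gTail k q qi lam q0i (Qf c) sA n) else 0) (by
    intro n f g hfg
    split_ifs with h1 h2
    · rfl
    · rw [gTail_congr (Qc' := Qf g) (Av' := sA) q qi lam q0i (by omega) h2 _ _ fun _ _ _ => rfl]
      · intro j hj
        simp only [Qf]
        rw [if_pos (show j ≤ k / 2 by omega), if_pos (show j ≤ k / 2 by omega)]
      · intro j hj hj'
        simp only [Qf]
        rw [hfg _ (by omega)]
    · rfl)
  let Qc := Qf c
  have hQk : Qc k = -1 := by
    simp only [Qc, Qf]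
    rw [if_neg (by omega), if_neg (by omega), if_pos le_rfl, hc]
    simp
  obtain ⟨Av, hAv⟩ := exists_recursive
    (fun n A => if n ≤ (k - 1) / 2 then sA n else
      if 2 * n = k then midTail k Qc A - t else
        if n < k then -h'Tail k q0i Qc A (k - n) else 0) (by
    intro n f g hfg
    split_ifs with h1 h2 h3
    · rfl
    · rw [midTail_congr (Av' := g) Qc fun j hj => hfg j (by omega)]
    · rw [h'Tail_congr (Av' := g) q0i Qc (by omega) fun j hj => hfg j (by omega)]
    · rfl)
  have hsA : ∀ j, j ≤ (k - 1) / 2 → Av j = sA j := fun j hj => by rw [hAv, if_pos hj]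
  refine ⟨Qc, Av, by simp [Qc, Qf], hQk, fun j hj => ?_, fun j hj => ?_, fun j hj hj' => ?_, hsA,
    fun he => ?_, fun l hl hlk => ⟨?_, ?_⟩⟩
  · simp only [Qc, Qf]
    rw [if_neg (by omega), if_neg (by omega), if_neg (by omega)]
  · rw [hAv, if_neg (by omega), if_neg (by omega), if_neg (by omega)]
  · simp only [Qc, Qf]
    rw [if_neg (by omega), if_pos hj']
  · have h : Av (k / 2) = midTail k Qc Av - t := by
      rw [hAv, if_neg (by omega), if_pos (by omega)]
    rw [h]
    ring
  · have h : Qc (k - l) = -(lam * q0 * gTail k q qi lam q0i Qc sA l) := by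
      simp only [Qc, Qf]
      rw [if_neg (by omega), if_neg (by omega), if_pos (by omega), hc, if_neg (by omega),
        if_pos (by omega), show k - (k - l) = l by omega]
    rw [h, gTail_congr (Av' := sA) q qi lam q0i hl hlk (fun _ _ => rfl) (fun _ _ _ => rfl)
      fun j _ hj => hsA j (by omega)]
    linear_combination (-q0 * q0i * gTail k q qi lam q0i Qc sA l) * hlam
      - gTail k q qi lam q0i Qc sA l * hq0
  · have h : Av (k - l) = -h'Tail k q0i Qc Av l := by
      rw [hAv, if_neg (by omega), if_neg (by omega), if_pos (by omega),
        show k - (k - l) = l by omega]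
    rw [h, neg_add_cancel]

/-- The value of a variable of `Ω` in `T`. -/
def oVarVal (k : ℕ) (q qi lam lami q0 q0i : T) (Qc Av : ℕ → T) : OVar k → T
  | .q => q
  | .qi => qi
  | .lam => lam
  | .lami => lami
  | .q0 => q0
  | .q0i => q0i
  | .qc i => Qc (i + 1)
  | .A i => Av i

theorem exists_hom {k : ℕ} {q qi lam lami q0 q0i : T} {Qc Av : ℕ → T} (hq : q * qi = 1)
    (hlam : lam * lami = 1) (hq0 : q0 * q0i = 1) (hQ0 : Qc 0 = q0) (hQk : Qc k = -1)
    (hQ : ∀ j, k < j → Qc j = 0) (hA : ∀ j, k ≤ j → Av j = 0) :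
    ∃ Φ : Omega k →+* T, Φ (vq k) = q ∧ Φ (vqi k) = qi ∧ Φ (vlam k) = lam ∧ Φ (vlami k) = lami ∧
      Φ (vq0 k) = q0 ∧ Φ (vq0i k) = q0i ∧ (∀ j, Φ (Qcv k j) = Qc j) ∧ ∀ j, Φ (vA k j) = Av j := by
  let v := oVarVal k q qi lam lami q0 q0i Qc Av
  let φ : OmegaP k →+* T := MvPolynomial.eval₂Hom (Int.castRingHom T) v
  have hφ : ∀ x, φ (MvPolynomial.X x) = v x := fun x => MvPolynomial.eval₂_X _ _ _
  have hle : ∀ x ∈ OmegaI k, φ x = 0 := by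
    suffices h : OmegaI k ≤ RingHom.ker φ from fun x hx => h hx
    refine Ideal.span_le.2 ?_
    rintro x (rfl | rfl | rfl) <;>
      simp only [SetLike.mem_coe, RingHom.mem_ker, map_sub, map_mul, map_one, hφ, v, oVarVal,
        hq, hlam, hq0, sub_self]
  have hlift : ∀ x, Ideal.Quotient.lift (OmegaI k) φ hle (mkO k (MvPolynomial.X x)) = v x :=
    fun x => (Ideal.Quotient.lift_mk _ _ _).trans (hφ x)
  refine ⟨Ideal.Quotient.lift (OmegaI k) φ hle, hlift _, hlift _, hlift _, hlift _, hlift _,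
    hlift _, fun j => ?_, fun j => ?_⟩
  · unfold Qcv vqc
    split_ifs with h1 h2 h3
    · rw [h1, hQ0]
      exact hlift _
    · rw [h2, hQk, map_neg, map_one]
    · refine (hlift _).trans ?_
      simp only [v, oVarVal]
      congr 1
      omega
    · rw [map_zero, hQ j (by omega)]
  · unfold vA
    split_ifs with h
    · exact hlift _
    · rw [map_zero, hA j (by omega)]

end Solutions

section Kernels

open Polynomial

variable {C K : Type} [CommRing C] [CommRing K]

/-- An elimination criterion: if `φ(d) b = φ(a)` with `a` a non-zero-divisor modulo an ideal `J`
whose elements `s` satisfy relations `s b = c`, then those relations generate the kernel of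
evaluation at `b`. -/
theorem mem_of_eval₂_eq_zero (φ : C →+* K) (b : K) (J : Ideal C) (L : Ideal C[X]) (d a : C)
    (hda : φ d * b = φ a) (hJ0 : ∀ c, φ c = 0 → c ∈ J) (hL0 : ∀ c, φ c = 0 → Polynomial.C c ∈ L)
    (hL : ∀ p ∈ L, p.eval₂ φ b = 0) (hdJ : d ∈ J) (haJ : ∀ c, a * c ∈ J → c ∈ J)
    (hJL : ∀ s ∈ J, ∃ c, Polynomial.C s * X - Polynomial.C c ∈ L) (p : C[X])
    (hp : p.eval₂ φ b = 0) : p ∈ L := by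
  suffices h : ∀ n, ∀ p : C[X], p.natDegree ≤ n → p.eval₂ φ b = 0 → p ∈ L from h _ p le_rfl hp
  intro n
  induction n with
  | zero =>
    intro p hn hp
    rw [eq_C_of_natDegree_le_zero hn] at hp ⊢
    exact hL0 _ (by rwa [eval₂_C] at hp)
  | succ n ih =>
    intro p hn hp
    have hpow : ∀ j, φ d ^ j * b ^ j = φ a ^ j := fun j => by rw [← mul_pow, hda]
    have hy : φ (∑ j ∈ Finset.range (n + 2), p.coeff j * d ^ (n + 1 - j) * a ^ j) = 0 := by
      rw [eval₂_eq_sum_range' φ (Nat.lt_succ_of_le hn)] at hp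
      have : φ (∑ j ∈ Finset.range (n + 2), p.coeff j * d ^ (n + 1 - j) * a ^ j)
          = φ d ^ (n + 1) * ∑ j ∈ Finset.range (n + 2), φ (p.coeff j) * b ^ j := by
        rw [map_sum, Finset.mul_sum]
        refine Finset.sum_congr rfl fun j hj => ?_
        rw [Finset.mem_range] at hj
        rw [map_mul, map_mul, map_pow, map_pow, ← hpow j,
          ← Nat.sub_add_cancel (show j ≤ n + 1 by omega), pow_add, Nat.add_sub_cancel]
        ring
      rw [this, hp, mul_zero]
    have hc : p.coeff (n + 1) ∈ J := by
      have h1 := hJ0 _ hy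
      rw [Finset.sum_range_succ, Nat.sub_self, pow_zero, mul_one] at h1
      have h2 : ∑ j ∈ Finset.range (n + 1), p.coeff j * d ^ (n + 1 - j) * a ^ j ∈ J := by
        refine J.sum_mem fun j hj => J.mul_mem_right _ (J.mul_mem_left _ ?_)
        rw [Finset.mem_range] at hj
        exact J.pow_mem_of_mem hdJ _ (by omega)
      have h3 : ∀ m c, a ^ m * c ∈ J → c ∈ J := by
        intro m
        induction m with
        | zero => intro c hc; simpa using hc
        | succ m ihm => intro c hc; exact ihm _ (haJ _ (by rwa [← mul_assoc, ← pow_succ']))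
      refine h3 (n + 1) _ ?_
      rw [mul_comm]
      exact (J.add_mem_iff_right h2).1 h1
    obtain ⟨c, hcL⟩ := hJL _ hc
    have hmem : (Polynomial.C (p.coeff (n + 1)) * X - Polynomial.C c) * X ^ n ∈ L :=
      L.mul_mem_right _ hcL
    have hrest : p - (Polynomial.C (p.coeff (n + 1)) * X - Polynomial.C c) * X ^ n ∈ L := by
      refine ih _ ?_ ?_
      · rw [natDegree_le_iff_coeff_eq_zero]
        intro N hN
        rw [sub_mul, mul_assoc, ← pow_succ', coeff_sub, coeff_sub, coeff_C_mul_X_pow,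
          coeff_C_mul_X_pow, if_neg (show N ≠ n by omega)]
        split_ifs with h
        · rw [h]; ring
        · rw [coeff_eq_zero_of_natDegree_lt (by omega)]; ring
      · rw [eval₂_sub, hp, hL _ hmem, sub_zero]
    simpa using L.add_mem hrest hmem

theorem dvd_of_dvd_mul_of_eval_ne_zero {D : Type} [CommRing D] [IsDomain D] {a c : D[X]}
    (h1 : a.eval 1 ≠ 0) (h2 : a.eval (-1) ≠ 0) (h : X ^ 2 - 1 ∣ a * c) :
    X ^ 2 - 1 ∣ c := by
  have hf : (X ^ 2 - 1 : D[X]) = (X - Polynomial.C 1) * (X - Polynomial.C (-1)) := by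
    simp only [map_one, map_neg]
    ring
  rw [hf] at h ⊢
  have h3 : X - Polynomial.C 1 ∣ c :=
    ((prime_X_sub_C (1 : D)).dvd_or_dvd (dvd_of_mul_right_dvd h)).resolve_left
      fun h => h1 (dvd_iff_isRoot.1 h)
  obtain ⟨e, rfl⟩ := h3
  rw [mul_left_comm] at h
  exact mul_dvd_mul_left _ (((prime_X_sub_C (-1 : D)).dvd_or_dvd
    ((mul_dvd_mul_iff_left (X_sub_C_ne_zero 1)).1 h)).resolve_left
      fun h => h2 (dvd_iff_isRoot.1 h))

theorem eval₂RingHom_C_mul_X_sub_C (φ : C →+* K) (b : K) (a c : C) :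
    eval₂RingHom φ b (Polynomial.C a * X - Polynomial.C c) = φ a * b - φ c := by
  simp

/-- For `C` a ring, `φ : C → K` injective and `a` regular modulo `d`, the polynomial `dX - a`
generates the kernel of evaluation at `b = a / d`. -/
theorem eval₂_eq_zero_imp_mem_span (φ : C →+* K) (hφ : Function.Injective φ) (b : K) (d a : C)
    (hda : φ d * b = φ a) (ha : ∀ c, d ∣ a * c → d ∣ c) (p : C[X]) (hp : p.eval₂ φ b = 0) :
    p ∈ Ideal.span {Polynomial.C d * X - Polynomial.C a} := by
  refine mem_of_eval₂_eq_zero φ b (Ideal.span {d}) _ d a hda (fun c hc => ?_) (fun c hc => ?_)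
    (fun p hp => ?_) (Ideal.mem_span_singleton_self d) (fun c hc => ?_) (fun s hs => ?_) p hp
  · rw [(map_eq_zero_iff φ hφ).1 hc]
    exact Ideal.zero_mem _
  · rw [(map_eq_zero_iff φ hφ).1 hc, map_zero]
    exact Ideal.zero_mem _
  · obtain ⟨r, rfl⟩ := Ideal.mem_span_singleton.1 hp
    rw [eval₂_mul, eval₂_sub, eval₂_mul, eval₂_C, eval₂_C, eval₂_X, hda, sub_self, zero_mul]
  · rw [Ideal.mem_span_singleton] at hc ⊢
    exact ha _ hc
  · obtain ⟨r, rfl⟩ := Ideal.mem_span_singleton.1 hs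
    refine ⟨a * r, Ideal.mem_span_singleton.2 ⟨Polynomial.C r, ?_⟩⟩
    rw [map_mul, map_mul]
    ring

/-- The kernel of evaluation of `D[Q][T][b]` at a generic matrix of rank one with rows `(d, v)`,
`(u, b)`, `(Q, T)` is generated by the three minors. -/
theorem eval_eq_zero_of_minors {D : Type} [CommRing D] [IsDomain D] (φ : D[X] →+* K)
    (hφ : Function.Injective φ) (t b : K) (d u v : D)
    (hu : ∀ c, d ∣ u * c → d ∣ c) (hv : ∀ c, d ∣ v * c → d ∣ c)
    (ht : φ (Polynomial.C d) * t = φ (Polynomial.C v * X))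
    (hb : φ (Polynomial.C d) * b = φ (Polynomial.C (u * v)))
    {R : Type} [CommRing R] (Ψ : D[X][X][X] →+* R) (Φ : R →+* K)
    (hΨ : Φ.comp Ψ = eval₂RingHom (eval₂RingHom φ t) b)
    (h1 : Ψ (Polynomial.C (Polynomial.C (Polynomial.C d) * X - Polynomial.C (Polynomial.C v * X)))
      = 0)
    (h2 : Ψ (Polynomial.C (Polynomial.C (Polynomial.C d)) * X
      - Polynomial.C (Polynomial.C (Polynomial.C (u * v)))) = 0)
    (h3 : Ψ (Polynomial.C (Polynomial.C X) * X
      - Polynomial.C (Polynomial.C (Polynomial.C u) * X)) = 0)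
    (p : D[X][X][X]) (hp : Φ (Ψ p) = 0) : Ψ p = 0 := by
  have hev : ∀ p, Φ (Ψ p) = p.eval₂ (eval₂RingHom φ t) b := fun p => congrArg (fun f => f p) hΨ
  let e : D[X][X] →+* D[X] := mapRingHom (evalRingHom 0)
  have heCC : ∀ r : D, e (Polynomial.C (Polynomial.C r)) = Polynomial.C r := fun r => by
    simp [e]
  have heX : e (Polynomial.C X) = 0 := by simp [e]
  let J : Ideal D[X][X] := (Ideal.span {Polynomial.C d}).comap e
  have hdvd : ∀ w : D, (∀ c, d ∣ w * c → d ∣ c) →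
      ∀ c : D[X], Polynomial.C d ∣ Polynomial.C w * c → Polynomial.C d ∣ c := by
    intro w hw c hc
    rw [C_dvd_iff_dvd_coeff] at hc ⊢
    exact fun i => hw _ (by simpa using hc i)
  have hker : ∀ c : D[X][X], c.eval₂ φ t = 0 →
      c ∈ Ideal.span {Polynomial.C (Polynomial.C d) * X - Polynomial.C (Polynomial.C v * X)} := by
    refine eval₂_eq_zero_imp_mem_span φ hφ t _ _ ht fun c hc => ?_
    rw [C_dvd_iff_dvd_coeff] at hc ⊢
    intro i
    have := hc (i + 1)
    rw [mul_assoc, coeff_C_mul, coeff_X_mul] at this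
    exact hv _ this
  refine mem_of_eval₂_eq_zero (eval₂RingHom φ t) b J (RingHom.ker Ψ) (Polynomial.C (Polynomial.C d))
    (Polynomial.C (Polynomial.C (u * v))) ?_ (fun c hc => ?_) (fun c hc => ?_) (fun p hp => ?_) ?_
    (fun c hc => ?_) (fun s hs => ?_) p ((hev p).symm.trans hp)
  · rw [coe_eval₂RingHom, eval₂_C, eval₂_C, hb]
  · obtain ⟨r, rfl⟩ := Ideal.mem_span_singleton.1 (hker c hc)
    refine Ideal.mul_mem_right _ _ ?_
    rw [Ideal.mem_comap, map_sub, map_mul, map_mul, map_mul, heCC, heX, mul_zero, sub_zero]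
    exact Ideal.mem_span_singleton.2 (dvd_mul_right _ _)
  · obtain ⟨r, rfl⟩ := Ideal.mem_span_singleton.1 (hker c hc)
    rw [RingHom.mem_ker, map_mul, map_mul, h1, zero_mul]
  · rw [← hev, (RingHom.mem_ker).1 hp, map_zero]
  · rw [Ideal.mem_comap, heCC]
    exact Ideal.mem_span_singleton_self _
  · rw [Ideal.mem_comap, Ideal.mem_span_singleton] at hc ⊢
    rw [map_mul, heCC, map_mul, mul_assoc] at hc
    exact hdvd v hv _ (hdvd u hu _ hc)
  · obtain ⟨r, hr⟩ := Ideal.mem_span_singleton.1 (Ideal.mem_comap.1 hs)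
    have h4 : Polynomial.C X ∣ s - Polynomial.C (Polynomial.C d) * r.map Polynomial.C := by
      rw [C_dvd_iff_dvd_coeff]
      intro i
      have h5 : e (s - Polynomial.C (Polynomial.C d) * r.map Polynomial.C) = 0 := by
        rw [map_sub, map_mul, heCC, hr, sub_eq_zero]
        congr 1
        ext
        simp [e]
      have h6 := congrArg (fun f => coeff f i) h5
      simp only [e, coe_mapRingHom, coeff_map, coe_evalRingHom, coeff_zero] at h6
      rwa [X_dvd_iff, coeff_zero_eq_eval_zero]
    obtain ⟨r', hr'⟩ := h4
    refine ⟨Polynomial.C (Polynomial.C (u * v)) * r.map Polynomial.C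
      + Polynomial.C (Polynomial.C u) * X * r', ?_⟩
    have h7 : s = Polynomial.C (Polynomial.C d) * r.map Polynomial.C + Polynomial.C X * r' := by
      rw [← hr']; ring
    have h8 : Polynomial.C s * X - Polynomial.C (Polynomial.C (Polynomial.C (u * v)) *
          r.map Polynomial.C + Polynomial.C (Polynomial.C u) * X * r')
        = (Polynomial.C (Polynomial.C (Polynomial.C d)) * X
            - Polynomial.C (Polynomial.C (Polynomial.C (u * v)))) *
              Polynomial.C (r.map Polynomial.C)
          + (Polynomial.C (Polynomial.C X) * X
            - Polynomial.C (Polynomial.C (Polynomial.C u) * X)) * Polynomial.C r' := by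
      rw [h7]
      simp only [map_add, map_mul]
      ring
    rw [h8, RingHom.mem_ker, map_add, Ψ.map_mul, Ψ.map_mul, h2, h3, zero_mul, zero_mul, add_zero]

end Kernels

section Generation

variable {R : Type} [CommRing R]

theorem Qcv_self {k : ℕ} (hk : 1 ≤ k) : Qcv k k = -1 := by
  rw [Qcv, if_neg (by omega), if_pos rfl]

theorem Qcv_succ {k : ℕ} (i : Fin (k - 1)) :
    Qcv k (i + 1) = mkO k (MvPolynomial.X (OVar.qc i)) := by
  have := i.isLt
  rw [Qcv, if_neg (by omega), if_neg (by omega), vqc, dif_pos (by omega)]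
  rfl

theorem subring_eq_top {k : ℕ} (hk : 1 ≤ k) (f : Omega k →+* R) (hf : Function.Surjective f)
    (S : Subring R) (h0 : f (hO k 0) = 0)
    (hl : ∀ l, 1 ≤ l → 2 * l < k → f (hO k l) = 0 ∧ f (h'O k l) = 0)
    (hlam0 : vlam k * vlami k = 1) (hq00 : vq0 k * vq0i k = 1)
    (hq : f (vq k) ∈ S) (hqi : f (vqi k) ∈ S) (hlam : f (vlam k) ∈ S) (hlami : f (vlami k) ∈ S)
    (hq0 : f (vq0 k) ∈ S) (hq0i : f (vq0i k) ∈ S)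
    (hQ : ∀ j, 1 ≤ j → j ≤ k / 2 → f (Qcv k j) ∈ S)
    (hA : ∀ j, j ≤ (k - 1) / 2 → f (vA k j) ∈ S)
    (hmid : k % 2 = 0 → f (midTail k (Qcv k) (vA k) - vA k (k / 2)) ∈ S) : S = ⊤ := by
  have hQ0 : f (Qcv k 0) ∈ S := by rwa [Qcv, if_pos rfl]
  have hQle : ∀ j, j ≤ k / 2 → f (Qcv k j) ∈ S := fun j hj => by
    rcases Nat.eq_zero_or_pos j with rfl | h
    · exact hQ0
    · exact hQ j h hj
  have hfQ : f (Qcv k k) = -1 := by rw [Qcv_self hk, map_neg, map_one]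
  have hQhigh : ∀ l, 2 * l < k → f (Qcv k (k - l)) ∈ S := by
    intro l
    induction l using Nat.strong_induction_on with
    | _ l ih =>
      intro hlk
      rcases Nat.eq_zero_or_pos l with rfl | h1
      · rw [Nat.sub_zero, hfQ]
        exact S.neg_mem S.one_mem
      · have hG := congrArg f (hElt_add_h'Elt k (vq k) (vqi k) (vlam k) (vlami k) (vq0i k)
          (Qcv k) (vA k) h1 hlk)
        obtain ⟨e1, e2⟩ := hl l h1 hlk
        rw [hO] at e1 h0
        rw [h'O] at e2
        have hT : f (gTail k (vq k) (vqi k) (vlam k) (vq0i k) (Qcv k) (vA k) l) ∈ S := by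
          refine gTail_mem (S.comap f) h1 hlk hq hqi hlam hq0i (fun j hj => hQle j (by omega))
            (fun j hj hj' => ?_) (fun j _ hj => hA j (by omega))
          have := ih (k - j) (by omega) (by omega)
          rwa [show k - (k - j) = j by omega] at this
        rw [map_add, map_add, map_mul, map_mul, e1, e2, h0, map_add, map_mul, map_mul] at hG
        have hlam1 := congrArg f hlam0
        have hq01 := congrArg f hq00
        rw [map_mul, map_one] at hlam1 hq01
        have h2 : f (Qcv k (k - l)) = -(f (vlam k) * f (vq0 k)) *
            f (gTail k (vq k) (vqi k) (vlam k) (vq0i k) (Qcv k) (vA k) l) := by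
          linear_combination (-f (vlam k) * f (vq0 k)) * hG
            - f (Qcv k (k - l)) * f (vq0 k) * f (vq0i k) * hlam1 - f (Qcv k (k - l)) * hq01
        rw [h2]
        exact S.mul_mem (S.neg_mem (S.mul_mem hlam hq0)) hT
  have hQall : ∀ j, f (Qcv k j) ∈ S := by
    intro j
    by_cases h1 : j ≤ k / 2
    · exact hQle j h1
    by_cases h2 : j ≤ k
    · have := hQhigh (k - j) (by omega)
      rwa [show k - (k - j) = j by omega] at this
    · rw [Qcv, if_neg (by omega), if_neg (by omega), vqc, dif_neg (by omega), map_zero]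
      exact S.zero_mem
  have hAall : ∀ j, f (vA k j) ∈ S := by
    intro j
    induction j using Nat.strong_induction_on with
    | _ j ih =>
      by_cases h1 : j ≤ (k - 1) / 2
      · exact hA j h1
      by_cases h2 : 2 * j = k
      · have h3 : k / 2 = j := by omega
        have h4 : f (midTail k (Qcv k) (vA k)) ∈ S :=
          midTail_mem (S.comap f) hQall fun i hi => ih i (by omega)
        have h5 := S.sub_mem h4 (hmid (by omega))
        rwa [← map_sub, sub_sub_cancel, h3] at h5
      by_cases h3 : j < k
      · obtain ⟨-, e2⟩ := hl (k - j) (by omega) (by omega)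
        rw [h'O, h'Elt_eq k _ _ _ (Qcv_self hk) (by omega), map_add,
          show k - (k - j) = j by omega] at e2
        rw [eq_neg_of_add_eq_zero_left e2]
        exact S.neg_mem (h'Tail_mem (S.comap f) (by omega) hq0i hQall fun i hi => ih i (by omega))
      · rw [vA, dif_neg h3, map_zero]
        exact S.zero_mem
  refine (Subring.eq_top_iff' S).2 fun x => ?_
  obtain ⟨x, rfl⟩ := hf x
  obtain ⟨p, rfl⟩ := Ideal.Quotient.mk_surjective x
  induction p using MvPolynomial.induction_on with
  | C n =>
    rw [eq_intCast MvPolynomial.C n, map_intCast, map_intCast]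
    exact intCast_mem S n
  | add p p' hp hp' => rw [map_add, map_add]; exact S.add_mem hp hp'
  | mul_X p i hp =>
    rw [map_mul, map_mul]
    refine S.mul_mem hp ?_
    cases i with
    | q => exact hq
    | qi => exact hqi
    | lam => exact hlam
    | lami => exact hlami
    | q0 => exact hq0
    | q0i => exact hq0i
    | qc i =>
      have := hQall (i + 1)
      rwa [Qcv_succ] at this
    | A i =>
      have := hAall i
      rwa [vA, dif_pos i.isLt] at this

/-- The elements that a power of `Ψ e` multiplies into the range of `Ψ`. -/
def saturation {E : Type} [CommRing E] (Ψ : E →+* R) (e : E) : Subring R where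
  carrier := {x | ∃ N : ℕ, Ψ e ^ N * x ∈ Ψ.range}
  one_mem' := ⟨0, by simp⟩
  zero_mem' := ⟨0, by simp⟩
  neg_mem' := fun ⟨N, h⟩ => ⟨N, by simpa using Ψ.range.neg_mem h⟩
  mul_mem' := fun ⟨N, h⟩ ⟨N', h'⟩ => ⟨N + N', by
    rw [pow_add, mul_mul_mul_comm]; exact Ψ.range.mul_mem h h'⟩
  add_mem' := fun {a b} ⟨N, h⟩ ⟨N', h'⟩ => ⟨N + N', by
    have he : ∀ n, Ψ e ^ n ∈ Ψ.range := fun n => ⟨e ^ n, map_pow _ _ _⟩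
    have : Ψ e ^ (N + N') * (a + b) = Ψ e ^ N' * (Ψ e ^ N * a) + Ψ e ^ N * (Ψ e ^ N' * b) := by
      ring
    rw [this]
    exact Ψ.range.add_mem (Ψ.range.mul_mem (he _) h) (Ψ.range.mul_mem (he _) h')⟩

theorem map_mem_saturation {E : Type} [CommRing E] (Ψ : E →+* R) (e p : E) :
    Ψ p ∈ saturation Ψ e := ⟨0, by simp⟩

theorem mem_saturation_of_mul {E : Type} [CommRing E] (Ψ : E →+* R) (e p : E) {x : R}
    (h : Ψ e * x = Ψ p) : x ∈ saturation Ψ e := ⟨1, p, by rw [pow_one, h]⟩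

theorem injective_of_saturation {E K : Type} [CommRing E] [CommRing K] (Ψ : E →+* R) (e : E)
    (hS : saturation Ψ e = ⊤) (he : IsUnit (Ψ e)) (Φ : R →+* K)
    (h : ∀ p, Φ (Ψ p) = 0 → Ψ p = 0) : Function.Injective Φ := by
  refine (injective_iff_map_eq_zero Φ).2 fun x hx => ?_
  obtain ⟨N, p, hp⟩ : x ∈ saturation Ψ e := by rw [hS]; exact Subring.mem_top x
  have h1 : Ψ e ^ N * x = 0 := by
    rw [← hp]
    exact h p (by rw [hp, map_mul, hx, mul_zero])
  exact (he.pow N).mul_right_eq_zero.1 h1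

end Generation

section Quotients

variable {k : ℕ}

theorem vq_mul_vqi : vq k * vqi k = 1 := by
  rw [vq, vqi, ← map_mul, ← map_one (mkO k), ← sub_eq_zero, ← map_sub]
  exact Ideal.Quotient.eq_zero_iff_mem.2 (Ideal.subset_span (by simp))

theorem vlam_mul_vlami : vlam k * vlami k = 1 := by
  rw [vlam, vlami, ← map_mul, ← map_one (mkO k), ← sub_eq_zero, ← map_sub]
  exact Ideal.Quotient.eq_zero_iff_mem.2 (Ideal.subset_span (by simp))

theorem vq0_mul_vq0i : vq0 k * vq0i k = 1 := by
  rw [vq0, vq0i, ← map_mul, ← map_one (mkO k), ← sub_eq_zero, ← map_sub]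
  exact Ideal.Quotient.eq_zero_iff_mem.2 (Ideal.subset_span (by simp))

theorem map_bs_eq_zero {R : Type} [CommRing R] {f : Omega k →+* R} {bs : Omega k}
    (hker : RingHom.ker f = Isig k bs) : f bs = 0 := by
  rw [← RingHom.mem_ker, hker]
  exact Ideal.subset_span (by simp)

theorem map_hO_zero {R : Type} [CommRing R] {f : Omega k →+* R} {bs : Omega k}
    (hker : RingHom.ker f = Isig k bs) : f (hO k 0) = 0 := by
  rw [← RingHom.mem_ker, hker]
  exact Ideal.subset_span (by simp)

theorem map_hO {R : Type} [CommRing R] {f : Omega k →+* R} {bs : Omega k}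
    (hker : RingHom.ker f = Isig k bs) {l : ℕ} (h1 : 1 ≤ l) (h2 : l ≤ k / 2) :
    f (hO k l) = 0 ∧ f (h'O k l) = 0 := by
  rw [← RingHom.mem_ker, ← RingHom.mem_ker, hker]
  exact ⟨Ideal.subset_span (Or.inr ⟨l, h1, h2, Or.inl rfl⟩),
    Ideal.subset_span (Or.inr ⟨l, h1, h2, Or.inr rfl⟩)⟩

theorem exists_quotient_hom {T R : Type} [CommRing T] [CommRing R] (hk : 1 ≤ k) {bs : Omega k}
    {f : Omega k →+* R} (hf : Function.Surjective f) (hker : RingHom.ker f = Isig k bs)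
    {q qi lam lami q0 q0i t : T} {sq sA : ℕ → T} (hq : q * qi = 1) (hlam : lam * lami = 1)
    (hq0 : q0 * q0i = 1) (h0 : lam - lami + (q - qi) * (sA 0 - 1) = 0)
    (hz : k % 2 = 0 → lami * (1 + q0i) * sq (k / 2) + (q - qi) * t = 0 ∧
      (q0i - 1) * t - sq (k / 2) * (sA 0 - 1 - q0i) = 0)
    (hbs : ∀ Φ : Omega k →+* T, Φ (vq k) = q → Φ (vqi k) = qi → Φ (vlam k) = lam →
      Φ (vq0i k) = q0i → Φ bs = 0) :
    ∃ Φ : R →+* T, Φ (f (vq k)) = q ∧ Φ (f (vqi k)) = qi ∧ Φ (f (vlam k)) = lam ∧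
      Φ (f (vq0i k)) = q0i ∧ (∀ j, 1 ≤ j → j ≤ k / 2 → Φ (f (Qcv k j)) = sq j) ∧
      (∀ j, j ≤ (k - 1) / 2 → Φ (f (vA k j)) = sA j) ∧
      (k % 2 = 0 → Φ (f (midTail k (Qcv k) (vA k) - vA k (k / 2))) = t) := by
  obtain ⟨Qc, Av, hQ0, hQk, hQ, hA, hsq, hsA, hmid, hrec⟩ :=
    exists_solution hk q qi hlam hq0 sq sA t
  obtain ⟨Φ, e1, e2, e3, e4, e5, e6, e7, e8⟩ := exists_hom hq hlam hq0 hQ0 hQk hQ hA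
  have e7' : (fun j => Φ (Qcv k j)) = Qc := funext e7
  have e8' : (fun j => Φ (vA k j)) = Av := funext e8
  have hh0 : hElt k q qi lam lami q0i Qc Av 0 = 0 := by
    rw [hElt, if_pos rfl, hsA 0 (Nat.zero_le _), h0]
  have hΦh : ∀ l, Φ (hO k l) = hElt k q qi lam lami q0i Qc Av l := fun l => by
    rw [hO, map_hElt, e1, e2, e3, e4, e6, e7', e8']
  have hΦh' : ∀ l, Φ (h'O k l) = h'Elt k q0i Qc Av l := fun l => by
    rw [h'O, map_h'Elt, e6, e7', e8']
  have hzero : ∀ l, 1 ≤ l → l ≤ k / 2 → Φ (hO k l) = 0 ∧ Φ (h'O k l) = 0 := by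
    intro l h1 h2
    rw [hΦh, hΦh']
    rcases Nat.lt_or_ge (2 * l) k with hlk | hlk
    · obtain ⟨r1, r2⟩ := hrec l h1 hlk
      rw [← h'Elt_eq k q0i Qc Av hQk (by omega)] at r2
      rw [← hElt_add_h'Elt k q qi lam lami q0i Qc Av h1 hlk, r2, hh0] at r1
      exact ⟨by simpa using r1, r2⟩
    · obtain rfl : l = k / 2 := by omega
      have he : k % 2 = 0 := by omega
      rw [hElt_mid hk he _ _ _ _ _ _ _ hQk, h'Elt_mid hk he _ _ _ hQk, hmid he,
        hsA 0 (Nat.zero_le _), hsq _ h1 h2]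
      exact hz he
  have hle : RingHom.ker f ≤ RingHom.ker Φ := by
    rw [hker]
    refine Ideal.span_le.2 ?_
    rintro x ((rfl | rfl) | ⟨l, h1, h2, rfl | rfl⟩)
    · exact hbs Φ e1 e2 e3 e6
    · exact (hΦh 0).trans hh0
    · exact (hzero l h1 h2).1
    · exact (hzero l h1 h2).2
  have hlift : ∀ x, f.liftOfSurjective hf ⟨Φ, hle⟩ (f x) = Φ x :=
    fun x => f.liftOfRightInverse_comp_apply _ (Function.rightInverse_surjInv hf) ⟨Φ, hle⟩ x
  refine ⟨f.liftOfSurjective hf ⟨Φ, hle⟩, ?_⟩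
  simp only [hlift]
  refine ⟨e1, e2, e3, e6, fun j h1 h2 => (e7 j).trans (hsq j h1 h2),
    fun j hj => (e8 j).trans (hsA j hj), fun he => ?_⟩
  rw [← hmid he, map_sub, e8]
  congr 1
  simp only [midTail, map_add, map_sub, map_sum, map_mul, e7, e8]

end Quotients

section BaseRing

open Polynomial

/-- The polynomial ring on the free coordinates of both components: `q` (or `-q⁻¹`), `λ`,
`q₁, …, q_m`, `A₁, …, A_m`. -/
def BaseRing (m : ℕ) : Type := (MvPolynomial (Option (Fin m ⊕ Fin m)) ℤ)[X]

noncomputable instance (m : ℕ) : CommRing (BaseRing m) :=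
  inferInstanceAs (CommRing (MvPolynomial (Option (Fin m ⊕ Fin m)) ℤ)[X])

instance (m : ℕ) : IsDomain (BaseRing m) :=
  inferInstanceAs (IsDomain (MvPolynomial (Option (Fin m ⊕ Fin m)) ℤ)[X])

/-- The free coordinate `q` or `-q⁻¹`. -/
noncomputable def baseX {m : ℕ} : BaseRing m :=
  (X : (MvPolynomial (Option (Fin m ⊕ Fin m)) ℤ)[X])

/-- The free coordinate `λ`, `q_i` or `A_i`. -/
noncomputable def baseVar {m : ℕ} (i : Option (Fin m ⊕ Fin m)) : BaseRing m :=
  (C (MvPolynomial.X i) : (MvPolynomial (Option (Fin m ⊕ Fin m)) ℤ)[X])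

variable {m : ℕ} {T : Type}

/-- Evaluation of `BaseRing m` at a point of `T`. -/
noncomputable def baseHom [CommRing T] (m : ℕ) (w lam : T) (sq sA : ℕ → T) : BaseRing m →+* T :=
  (eval₂RingHom (MvPolynomial.eval₂Hom (Int.castRingHom T)
    (Option.elim · lam (Sum.elim (fun i => sq (i + 1)) fun i => sA (i + 1)))) w :
      (MvPolynomial (Option (Fin m ⊕ Fin m)) ℤ)[X] →+* T)

@[simp] theorem baseHom_baseX [CommRing T] (w lam : T) (sq sA : ℕ → T) :
    baseHom m w lam sq sA baseX = w :=
  eval₂_X _ _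

theorem baseHom_baseVar [CommRing T] (w lam : T) (sq sA : ℕ → T)
    (i : Option (Fin m ⊕ Fin m)) : baseHom m w lam sq sA (baseVar i) =
      i.elim lam (Sum.elim (fun i => sq (i + 1)) fun i => sA (i + 1)) :=
  (eval₂_C _ _).trans (MvPolynomial.eval₂_X _ _ _)

@[simp] theorem baseHom_none [CommRing T] (w lam : T) (sq sA : ℕ → T) :
    baseHom m w lam sq sA (baseVar none) = lam := baseHom_baseVar _ _ _ _ _

@[simp] theorem baseHom_inl [CommRing T] (w lam : T) (sq sA : ℕ → T) (i : Fin m) :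
    baseHom m w lam sq sA (baseVar (some (.inl i))) = sq (i + 1) := baseHom_baseVar _ _ _ _ _

@[simp] theorem baseHom_inr [CommRing T] (w lam : T) (sq sA : ℕ → T) (i : Fin m) :
    baseHom m w lam sq sA (baseVar (some (.inr i))) = sA (i + 1) := baseHom_baseVar _ _ _ _ _

theorem baseRing_hom_ext [CommRing T] {f g : BaseRing m →+* T} (hX : f baseX = g baseX)
    (hv : ∀ i, f (baseVar i) = g (baseVar i)) : f = g :=
  Polynomial.ringHom_ext' (R := MvPolynomial (Option (Fin m ⊕ Fin m)) ℤ)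
    (MvPolynomial.ringHom_ext (fun n => by simp) hv) hX

theorem baseX_ne_zero : (baseX : BaseRing m) ≠ 0 :=
  X_ne_zero (R := MvPolynomial (Option (Fin m ⊕ Fin m)) ℤ)

theorem baseVar_ne_zero (i : Option (Fin m ⊕ Fin m)) : baseVar i ≠ 0 :=
  C_ne_zero.2 (MvPolynomial.X_ne_zero i)

/-- Extends a sequence defined on `1, …, m` by a given function. -/
def extendSeq (a : Fin m → T) (b : ℕ → T) (j : ℕ) : T :=
  if h : 1 ≤ j ∧ j ≤ m then a ⟨j - 1, by omega⟩ else b j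

theorem extendSeq_succ (a : Fin m → T) (b : ℕ → T) (i : Fin m) :
    extendSeq a b (i + 1) = a i := by
  rw [extendSeq, dif_pos ⟨by omega, i.isLt⟩]
  rfl

theorem extendSeq_of_not (a : Fin m → T) (b : ℕ → T) {j : ℕ} (h : ¬(1 ≤ j ∧ j ≤ m)) :
    extendSeq a b j = b j := dif_neg h

theorem baseX_sq_sub_one_ne_zero : (baseX ^ 2 - 1 : BaseRing m) ≠ 0 := by
  intro h
  simpa using congrArg (baseHom m (2 : ℤ) 0 0 0) h

theorem dvd_of_dvd_mul_base {a c : BaseRing m}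
    (h1 : baseHom m (1 : ℤ) 2 0 0 a ≠ 0) (h2 : baseHom m (-1 : ℤ) 2 0 0 a ≠ 0)
    (h : baseX ^ 2 - 1 ∣ a * c) : baseX ^ 2 - 1 ∣ c := by
  let E := MvPolynomial (Option (Fin m ⊕ Fin m)) ℤ
  have key (n : ℤ) (h0 : eval (n : E) (show E[X] from a) = 0) : baseHom m n 2 0 0 a = 0 := by
    let ι : E →+* BaseRing m := (C : E →+* E[X])
    have : baseHom m n 2 0 0 = ((baseHom m n 2 0 0).comp ι).comp
        (show BaseRing m →+* E from evalRingHom (n : E)) := by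
      refine baseRing_hom_ext ?_ fun i => ?_
      · refine (baseHom_baseX _ _ _ _).trans ?_
        refine Eq.trans ?_ (congrArg ((baseHom m n 2 0 0).comp ι) (eval_X (x := (n : E))).symm)
        simp
      · exact congrArg ((baseHom m n 2 0 0).comp ι) (eval_C (x := (n : E))).symm
    rw [this]
    exact (congrArg ((baseHom m n 2 0 0).comp ι) h0).trans (map_zero _)
  refine dvd_of_dvd_mul_of_eval_ne_zero (D := E) (fun h0 => h1 (key 1 ?_))
    (fun h0 => h2 (key (-1) ?_)) h
  · rwa [Int.cast_one]
  · rwa [Int.cast_neg, Int.cast_one]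

end BaseRing

section OddComponent

open Polynomial

variable {k : ℕ} {R : Type} [CommRing R]

/-- The restriction of `f` to the free coordinates. -/
noncomputable def baseRestrict (f : Omega k →+* R) (w : R) : BaseRing ((k - 1) / 2) →+* R :=
  baseHom _ w (f (vlam k)) (fun j => f (Qcv k j)) fun j => f (vA k j)

/-- The free coordinates together with `-λ q⁻¹ (A₀ - 1)` generate the odd components. -/
noncomputable def oddHom (f : Omega k →+* R) : (BaseRing ((k - 1) / 2))[X] →+* R :=
  eval₂RingHom (baseRestrict f (f (vq k))) (-f (vlam k) * (f (vA k 0) - 1) * f (vqi k))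

theorem oddHom_C (f : Omega k →+* R) (p : BaseRing ((k - 1) / 2)) :
    oddHom f (C p) = baseRestrict f (f (vq k)) p := eval₂_C _ _

theorem oddHom_X (f : Omega k →+* R) :
    oddHom f X = -f (vlam k) * (f (vA k 0) - 1) * f (vqi k) := eval₂_X _ _

theorem map_vq_mul (f : Omega k →+* R) : f (vq k) * f (vqi k) = 1 := by
  rw [← map_mul, vq_mul_vqi, map_one]

theorem map_vlam_mul (f : Omega k →+* R) : f (vlam k) * f (vlami k) = 1 := by
  rw [← map_mul, vlam_mul_vlami, map_one]

theorem map_vq0_mul (f : Omega k →+* R) : f (vq0 k) * f (vq0i k) = 1 := by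
  rw [← map_mul, vq0_mul_vq0i, map_one]

theorem map_hO_zero_eq {f : Omega k →+* R} {bs : Omega k} (hker : RingHom.ker f = Isig k bs) :
    f (vlam k) - f (vlami k) + (f (vq k) - f (vqi k)) * (f (vA k 0) - 1) = 0 := by
  have := map_hO_zero hker
  rwa [hO, map_hElt, hElt, if_pos rfl] at this

theorem odd_exists_hom (hk : k % 2 = 1) {s : ℤ} (hs : s * s = 1)
    {bs : Omega k} {f : Omega k →+* R} (hf : Function.Surjective f)
    (hker : RingHom.ker f = Isig k bs) (hbs : vq0i k - s * vlam k ∣ bs)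
    {K : Type} [Field K] (φ : BaseRing ((k - 1) / 2) →+* K) (hφ : Function.Injective φ) :
    ∃ (Φ : R →+* K) (b : K), φ (baseX ^ 2 - 1) * b = φ (baseVar none ^ 2 - 1) ∧
      Φ.comp (oddHom f) = eval₂RingHom φ b := by
  have hφ0 : ∀ {x}, x ≠ 0 → φ x ≠ 0 := fun hx => (map_ne_zero_iff φ hφ).2 hx
  obtain ⟨w, hwdef⟩ : ∃ w, φ baseX = w := ⟨_, rfl⟩
  obtain ⟨lam, hldef⟩ : ∃ lam, φ (baseVar none) = lam := ⟨_, rfl⟩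
  have hw : w * w⁻¹ = 1 := mul_inv_cancel₀ (hwdef ▸ hφ0 baseX_ne_zero)
  have hlam : lam * lam⁻¹ = 1 := mul_inv_cancel₀ (hldef ▸ hφ0 (baseVar_ne_zero _))
  have hsK : (s : K) * s = 1 := by rw [← Int.cast_mul, hs, Int.cast_one]
  obtain ⟨b, hb⟩ : ∃ b, φ (baseX ^ 2 - 1) * b = φ (baseVar none ^ 2 - 1) :=
    ⟨_, mul_div_cancel₀ _ (hφ0 baseX_sq_sub_one_ne_zero)⟩
  have hb' : (w ^ 2 - 1) * b = lam ^ 2 - 1 := by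
    rwa [map_sub, map_sub, map_pow, map_pow, map_one, hwdef, hldef] at hb
  let sA : ℕ → K := extendSeq (fun i => φ (baseVar (some (.inr i)))) fun _ => 1 - lam⁻¹ * w * b
  have hsA0 : sA 0 = 1 - lam⁻¹ * w * b := extendSeq_of_not _ _ (by omega)
  obtain ⟨Φ, e1, e2, e3, e4, e5, e6, -⟩ := exists_quotient_hom (T := K) (q := w) (qi := w⁻¹)
    (lam := lam) (lami := lam⁻¹) (q0 := s * lam⁻¹) (q0i := s * lam) (t := 0)
    (sq := extendSeq (fun i => φ (baseVar (some (.inl i)))) 0) (sA := sA)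
    (by omega : 1 ≤ k) hf hker hw hlam
    (by linear_combination lam * lam⁻¹ * hsK + hlam)
    (by
      rw [hsA0]
      linear_combination (-lam⁻¹) * hb' + lam⁻¹ * b * hw - lam * hlam)
    (fun h => absurd h (by omega))
    (fun Φ _ _ h3 h4 => by
      obtain ⟨c, rfl⟩ := hbs
      rw [map_mul, map_sub, map_mul, map_intCast, h3, h4, sub_self, zero_mul])
  refine ⟨Φ, b, hb, Polynomial.ringHom_ext' (baseRing_hom_ext ?_ ?_) ?_⟩
  · simp [oddHom, baseRestrict, e1, hwdef]
  · rintro (_ | i | i)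
    · simp [oddHom, baseRestrict, e3, hldef]
    · simp only [RingHom.comp_apply, oddHom_C, baseRestrict, baseHom_inl, coe_eval₂RingHom, eval₂_C]
      rw [e5 _ (by omega) (by omega)]
      exact extendSeq_succ _ _ _
    · simp only [RingHom.comp_apply, oddHom_C, baseRestrict, baseHom_inr, coe_eval₂RingHom, eval₂_C]
      rw [e6 _ (by omega)]
      exact extendSeq_succ _ _ _
  · simp only [RingHom.comp_apply, oddHom_X, map_mul, map_neg, map_sub, map_one, coe_eval₂RingHom,
      eval₂_X, e2, e3, e6 0 (Nat.zero_le _), hsA0]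
    linear_combination (b * w * w⁻¹) * hlam + b * hw

theorem saturation_odd (hk : k % 2 = 1) {s : ℤ} (hs : s * s = 1)
    {bs : Omega k} {f : Omega k →+* R} (hf : Function.Surjective f)
    (hker : RingHom.ker f = Isig k bs) (hbs : bs ∣ vq0i k - s * vlam k) :
    saturation (oddHom f) (C (baseX * baseVar none)) = ⊤ := by
  have hq := map_vq_mul f
  have hl := map_vlam_mul f
  have hq0i : f (vq0i k) = s * f (vlam k) := by
    obtain ⟨c, hc⟩ := hbs
    have := congrArg f hc
    rw [map_mul, map_bs_eq_zero hker, zero_mul, map_sub, map_mul, map_intCast] at this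
    exact sub_eq_zero.1 this
  have hsR : (s : R) * s = 1 := by rw [← Int.cast_mul, hs, Int.cast_one]
  have hC : ∀ p, baseRestrict f (f (vq k)) p ∈ saturation (oddHom f) (C (baseX * baseVar none)) :=
    fun p => by rw [← oddHom_C]; exact map_mem_saturation _ _ _
  have mlam : f (vlam k) ∈ saturation (oddHom f) (C (baseX * baseVar none)) := by
    simpa [baseRestrict] using hC (baseVar none)
  have mq : f (vq k) ∈ saturation (oddHom f) (C (baseX * baseVar none)) := by
    simpa [baseRestrict] using hC baseX
  have mlami : f (vlami k) ∈ saturation (oddHom f) (C (baseX * baseVar none)) := by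
    refine mem_saturation_of_mul _ _ (C baseX) ?_
    simp only [oddHom_C, baseRestrict, map_mul, baseHom_baseX, baseHom_none]
    linear_combination f (vq k) * hl
  have mqi : f (vqi k) ∈ saturation (oddHom f) (C (baseX * baseVar none)) := by
    refine mem_saturation_of_mul _ _ (C (baseVar none)) ?_
    simp only [oddHom_C, baseRestrict, map_mul, baseHom_baseX, baseHom_none]
    linear_combination f (vlam k) * hq
  refine subring_eq_top (by omega) f hf _ (map_hO_zero hker)
    (fun l h1 h2 => map_hO hker h1 (by omega)) vlam_mul_vlami
    vq0_mul_vq0i mq mqi mlam mlami ?_ ?_ ?_ ?_ (fun h => absurd h (by omega))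
  · have : f (vq0 k) = s * f (vlami k) := by
      linear_combination s * f (vlami k) * map_vq0_mul f - s * f (vlami k) * f (vq0 k) * hq0i
        - f (vq0 k) * s * s * hl - f (vq0 k) * hsR
    rw [this]
    exact Subring.mul_mem _ (intCast_mem _ s) mlami
  · rw [hq0i]
    exact Subring.mul_mem _ (intCast_mem _ s) mlam
  · intro j h1 h2
    have := hC (baseVar (some (.inl ⟨j - 1, by omega⟩)))
    rw [baseRestrict, baseHom_inl] at this
    simpa only [Nat.sub_add_cancel h1] using this
  · intro j hj
    rcases Nat.eq_zero_or_pos j with rfl | h1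
    · have : f (vA k 0) = 1 - f (vlami k) * f (vq k) * oddHom f X := by
        rw [oddHom_X]
        linear_combination (-(f (vA k 0) - 1) * f (vq k) * f (vqi k)) * hl
          - (f (vA k 0) - 1) * hq
      rw [this]
      exact Subring.sub_mem _ (Subring.one_mem _)
        (Subring.mul_mem _ (Subring.mul_mem _ mlami mq) (map_mem_saturation _ _ _))
    · have := hC (baseVar (some (.inr ⟨j - 1, by omega⟩)))
      rw [baseRestrict, baseHom_inr] at this
      simpa only [Nat.sub_add_cancel h1] using this

theorem isDomain_odd (hk : k % 2 = 1) {s : ℤ} (hs : s * s = 1)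
    {bs : Omega k} {f : Omega k →+* R} (hf : Function.Surjective f)
    (hker : RingHom.ker f = Isig k bs) (hbs : bs ∣ vq0i k - s * vlam k)
    (hbs' : vq0i k - s * vlam k ∣ bs) : IsDomain R ∧ f 2 ≠ 0 := by
  let φ := algebraMap (BaseRing ((k - 1) / 2)) (FractionRing (BaseRing ((k - 1) / 2)))
  have hφ : Function.Injective φ := IsFractionRing.injective _ _
  obtain ⟨Φ, b, hb, hΦ⟩ := odd_exists_hom hk hs hf hker hbs' φ hφ
  have hq := map_vq_mul f
  have hl := map_vlam_mul f
  have hinj : Function.Injective Φ := by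
    refine injective_of_saturation _ _ (saturation_odd hk hs hf hker hbs) ?_ Φ fun p hp => ?_
    · simp only [oddHom_C, baseRestrict, map_mul, baseHom_baseX, baseHom_none]
      exact (IsUnit.of_mul_eq_one _ hq).mul (IsUnit.of_mul_eq_one _ hl)
    · have hp' : p.eval₂ φ b = 0 := by
        rw [← hp, ← coe_eval₂RingHom, ← hΦ, RingHom.comp_apply]
      obtain ⟨r, rfl⟩ := Ideal.mem_span_singleton.1 <| eval₂_eq_zero_imp_mem_span φ hφ b
        (baseX ^ 2 - 1) (baseVar none ^ 2 - 1) hb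
        (fun c hc => dvd_of_dvd_mul_base (by simp) (by simp) hc) p hp'
      rw [RingHom.map_mul, RingHom.map_sub, RingHom.map_mul, oddHom_C, oddHom_C, oddHom_X]
      simp only [map_sub, map_pow, map_one, baseRestrict, baseHom_baseX, baseHom_none]
      linear_combination oddHom f r * (f (vlam k) * (-(f (vA k 0) - 1) * f (vq k) * hq
        - map_hO_zero_eq hker) - hl)
  refine ⟨hinj.isDomain Φ, fun h2 => ?_⟩
  have h3 := congrArg Φ h2
  rw [map_ofNat, map_ofNat, map_zero] at h3
  have h4 := congrArg (baseHom ((k - 1) / 2) (0 : ℤ) 0 0 0)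
    ((map_eq_zero_iff φ hφ).1 ((map_ofNat φ 2).trans h3))
  rw [map_ofNat, map_zero] at h4
  exact absurd h4 (by norm_num)

end OddComponent

section EvenComponent

open Polynomial

variable {k : ℕ} {R : Type} [CommRing R]

/-- The free coordinates together with `q_z`, `-λ w⁻¹ (midTail - A_z)` and
`λ w⁻¹ (q₀⁻¹ + 1 - A₀)` generate the even components, where `w` is `q` or `-q⁻¹`. -/
noncomputable def evenHom (f : Omega k →+* R) (w wi : Omega k) :
    (BaseRing ((k - 1) / 2))[X][X][X] →+* R :=
  eval₂RingHom (eval₂RingHom (eval₂RingHom (baseRestrict f (f w)) (f (Qcv k (k / 2))))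
    (-f (vlam k) * f (midTail k (Qcv k) (vA k) - vA k (k / 2)) * f wi))
    (f (vlam k) * (f (vq0i k) - (f (vA k 0) - 1)) * f wi)

theorem evenHom_CCC (f : Omega k →+* R) (w wi : Omega k) (p : BaseRing ((k - 1) / 2)) :
    evenHom f w wi (C (C (C p))) = baseRestrict f (f w) p := by
  simp [evenHom]

theorem evenHom_CCX (f : Omega k →+* R) (w wi : Omega k) :
    evenHom f w wi (C (C X)) = f (Qcv k (k / 2)) := by
  simp [evenHom]

theorem evenHom_CX (f : Omega k →+* R) (w wi : Omega k) :
    evenHom f w wi (C X) =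
      -f (vlam k) * f (midTail k (Qcv k) (vA k) - vA k (k / 2)) * f wi := by
  rw [evenHom, coe_eval₂RingHom, eval₂_C, coe_eval₂RingHom, eval₂_X]

theorem evenHom_X (f : Omega k →+* R) (w wi : Omega k) :
    evenHom f w wi X = f (vlam k) * (f (vq0i k) - (f (vA k 0) - 1)) * f wi := eval₂_X _ _

theorem evenHom_C_mul_X_sub_C (f : Omega k →+* R) (w wi : Omega k)
    (a c : (BaseRing ((k - 1) / 2))[X][X]) : evenHom f w wi (C a * X - C c) =
      evenHom f w wi (C a) * (f (vlam k) * (f (vq0i k) - (f (vA k 0) - 1)) * f wi) -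
        evenHom f w wi (C c) := by
  have hC : ∀ p, evenHom f w wi (C p) = _ := fun p => eval₂_C _ _
  rw [hC, hC]
  exact eval₂RingHom_C_mul_X_sub_C _ _ a c

theorem even_exists_hom (hk1 : 1 ≤ k) (hk : k % 2 = 0) {w wi : Omega k}
    (hw : w = vq k ∧ wi = vqi k ∨ w = -vqi k ∧ wi = -vq k)
    {bs : Omega k} {f : Omega k →+* R} (hf : Function.Surjective f)
    (hker : RingHom.ker f = Isig k bs) (hbs : vq0i k - w * vlam k ∣ bs)
    {K : Type} [Field K] (φ : (BaseRing ((k - 1) / 2))[X] →+* K) (hφ : Function.Injective φ) :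
    ∃ (Φ : R →+* K) (t b : K),
      φ (C (baseX ^ 2 - 1)) * t = φ (C (baseX * baseVar none + 1) * X) ∧
      φ (C (baseX ^ 2 - 1)) * b = φ (C ((baseX * baseVar none - 1) * (baseX * baseVar none + 1))) ∧
      Φ.comp (evenHom f w wi) = eval₂RingHom (eval₂RingHom φ t) b := by
  have hφ0 : ∀ {x}, x ≠ 0 → φ x ≠ 0 := fun hx => (map_ne_zero_iff φ hφ).2 hx
  obtain ⟨ω, hωdef⟩ : ∃ ω, φ (C baseX) = ω := ⟨_, rfl⟩
  obtain ⟨lam, hldef⟩ : ∃ lam, φ (C (baseVar none)) = lam := ⟨_, rfl⟩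
  obtain ⟨Q, hQdef⟩ : ∃ Q, φ X = Q := ⟨_, rfl⟩
  have hω : ω * ω⁻¹ = 1 := mul_inv_cancel₀ (hωdef ▸ hφ0 (C_ne_zero.2 baseX_ne_zero))
  have hlam : lam * lam⁻¹ = 1 :=
    mul_inv_cancel₀ (hldef ▸ hφ0 (C_ne_zero.2 (baseVar_ne_zero _)))
  have hd0 : φ (C (baseX ^ 2 - 1)) ≠ 0 := hφ0 (C_ne_zero.2 baseX_sq_sub_one_ne_zero)
  obtain ⟨t, ht⟩ : ∃ t, φ (C (baseX ^ 2 - 1)) * t = φ (C (baseX * baseVar none + 1) * X) :=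
    ⟨_, mul_div_cancel₀ _ hd0⟩
  obtain ⟨b, hb⟩ : ∃ b, φ (C (baseX ^ 2 - 1)) * b =
      φ (C ((baseX * baseVar none - 1) * (baseX * baseVar none + 1))) := ⟨_, mul_div_cancel₀ _ hd0⟩
  have hd : φ (C (baseX ^ 2 - 1)) = ω ^ 2 - 1 := by
    simp only [map_sub, map_pow, map_one, hωdef]
  have ht' : (ω ^ 2 - 1) * t = (ω * lam + 1) * Q := by
    rw [← hd, ht]
    simp only [map_add, map_mul, map_one, hωdef, hldef, hQdef]
  have hb' : (ω ^ 2 - 1) * b = (ω * lam - 1) * (ω * lam + 1) := by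
    rw [← hd, hb]
    simp only [map_add, map_sub, map_mul, map_one, hωdef, hldef]
  have hQb : Q * b = (ω * lam - 1) * t := by
    rw [hd] at hd0
    refine mul_left_cancel₀ hd0 ?_
    linear_combination Q * hb' - (ω * lam - 1) * ht'
  let sA : ℕ → K := extendSeq (fun i => φ (C (baseVar (some (.inr i)))))
    fun _ => 1 + ω * lam - ω * b * lam⁻¹
  have hsA0 : sA 0 = 1 + ω * lam - ω * b * lam⁻¹ := extendSeq_of_not _ _ (by omega)
  let sq : ℕ → K := extendSeq (fun i => φ (C (baseVar (some (.inl i))))) fun _ => Q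
  have hsqz : sq (k / 2) = Q := extendSeq_of_not _ _ (by omega)
  have key : ∃ q qi : K, q * qi = 1 ∧ q - qi = ω - ω⁻¹ ∧
      ∀ (g : Omega k →+* K), g (vq k) = q → g (vqi k) = qi → g w = ω ∧ g wi = ω⁻¹ := by
    rcases hw with ⟨rfl, rfl⟩ | ⟨rfl, rfl⟩
    · exact ⟨ω, ω⁻¹, hω, rfl, fun g h1 h2 => ⟨h1, h2⟩⟩
    · exact ⟨-ω⁻¹, -ω, by rw [neg_mul_neg, mul_comm, hω], by ring,
        fun g h1 h2 => ⟨by rw [map_neg, h2, neg_neg], by rw [map_neg, h1, neg_neg]⟩⟩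
  obtain ⟨q, qi, hq, hqd, hg⟩ := key
  obtain ⟨Φ, e1, e2, e3, e4, e5, e6, e7⟩ := exists_quotient_hom (T := K) (q := q) (qi := qi)
    (lam := lam) (lami := lam⁻¹) (q0 := ω⁻¹ * lam⁻¹) (q0i := ω * lam) (t := -ω * t * lam⁻¹)
    (sq := sq) (sA := sA) hk1 hf hker hq hlam
    (by linear_combination lam * lam⁻¹ * hω + hlam)
    (by
      rw [hsA0, hqd]
      linear_combination (-lam⁻¹) * hb' + lam⁻¹ * b * hω - lam * hω - lam * ω ^ 2 * hlam)
    (fun _ => by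
      rw [hsA0, hsqz, hqd]
      constructor
      · linear_combination (-lam⁻¹) * ht' + t * lam⁻¹ * hω
      · linear_combination ω * lam⁻¹ * hQb)
    (fun Φ h1 h2 h3 h4 => by
      obtain ⟨c, rfl⟩ := hbs
      rw [map_mul, map_sub, map_mul, (hg Φ h1 h2).1, h3, h4, sub_self, zero_mul])
  obtain ⟨e8, e9⟩ := hg (Φ.comp f) e1 e2
  rw [RingHom.comp_apply] at e8 e9
  refine ⟨Φ, t, b, ht, hb, Polynomial.ringHom_ext' (Polynomial.ringHom_ext'
    (Polynomial.ringHom_ext' (baseRing_hom_ext ?_ ?_) ?_) ?_) ?_⟩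
  · simp only [RingHom.comp_apply, evenHom_CCC, baseRestrict, baseHom_baseX, coe_eval₂RingHom,
      eval₂_C,
      e8, hωdef]
  · rintro (_ | i | i)
    · simp only [RingHom.comp_apply, evenHom_CCC, baseRestrict, baseHom_none, coe_eval₂RingHom,
        eval₂_C, e3, hldef]
    · simp only [RingHom.comp_apply, evenHom_CCC, baseRestrict, baseHom_inl, coe_eval₂RingHom,
        eval₂_C]
      rw [e5 _ (by omega) (by omega)]
      exact extendSeq_succ _ _ _
    · simp only [RingHom.comp_apply, evenHom_CCC, baseRestrict, baseHom_inr, coe_eval₂RingHom,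
        eval₂_C]
      rw [e6 _ (by omega)]
      exact extendSeq_succ _ _ _
  · simp only [RingHom.comp_apply, evenHom_CCX, coe_eval₂RingHom, eval₂_C, hQdef]
    rw [e5 _ (by omega) le_rfl, hsqz]
  · simp only [RingHom.comp_apply, evenHom_CX, coe_eval₂RingHom, eval₂_C, eval₂_X, map_mul, map_neg,
      e3, e7 hk, e9]
    linear_combination (t * ω * ω⁻¹) * hlam + t * hω
  · simp only [RingHom.comp_apply, evenHom_X, coe_eval₂RingHom, eval₂_X, map_mul, map_sub, map_one,
      e3, e4, e6 0 (Nat.zero_le _), e9, hsA0]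
    linear_combination (b * ω * ω⁻¹) * hlam + b * hω

theorem saturation_even (hk1 : 1 ≤ k) (hk : k % 2 = 0) {w wi : Omega k}
    (hw : w = vq k ∧ wi = vqi k ∨ w = -vqi k ∧ wi = -vq k) (hwi : w * wi = 1)
    {bs : Omega k} {f : Omega k →+* R} (hf : Function.Surjective f)
    (hker : RingHom.ker f = Isig k bs) (hq0i : f (vq0i k) = f w * f (vlam k)) :
    saturation (E := (BaseRing ((k - 1) / 2))[X][X][X]) (evenHom f w wi)
      (C (C (C (baseX * baseVar none)))) = ⊤ := by
  have hω : f w * f wi = 1 := by rw [← map_mul, hwi, map_one]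
  have hl := map_vlam_mul f
  generalize hS : saturation (E := (BaseRing ((k - 1) / 2))[X][X][X]) (evenHom f w wi)
    (C (C (C (baseX * baseVar none)))) = S
  have hE : ∀ p, evenHom f w wi p ∈ S := fun p => by rw [← hS]; exact map_mem_saturation _ _ _
  have hmul : ∀ p x, evenHom f w wi (C (C (C (baseX * baseVar none)))) * x = evenHom f w wi p →
      x ∈ S := fun p x h => by rw [← hS]; exact mem_saturation_of_mul _ _ _ h
  have hC : ∀ p, baseRestrict f (f w) p ∈ S := fun p => by
    rw [← evenHom_CCC f w wi]; exact hE _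
  have mlam : f (vlam k) ∈ S := by
    simpa [baseRestrict] using hC (baseVar none)
  have mw : f w ∈ S := by
    simpa [baseRestrict] using hC baseX
  have mlami : f (vlami k) ∈ S := by
    refine hmul (C (C (C baseX))) _ ?_
    simp only [evenHom_CCC, baseRestrict]
    rw [map_mul, baseHom_baseX, baseHom_none]
    linear_combination f w * hl
  have mwi : f wi ∈ S := by
    refine hmul (C (C (C (baseVar none)))) _ ?_
    simp only [evenHom_CCC, baseRestrict]
    rw [map_mul, baseHom_baseX, baseHom_none]
    linear_combination f (vlam k) * hω
  have mq : f (vq k) ∈ S ∧ f (vqi k) ∈ S := by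
    rcases hw with ⟨rfl, rfl⟩ | ⟨rfl, rfl⟩
    · exact ⟨mw, mwi⟩
    · rw [map_neg, neg_mem_iff] at mw mwi
      exact ⟨mwi, mw⟩
  refine subring_eq_top hk1 f hf _ (map_hO_zero hker)
    (fun l h1 h2 => map_hO hker h1 (by omega)) vlam_mul_vlami
    vq0_mul_vq0i mq.1 mq.2 mlam mlami ?_ ?_ ?_ ?_ fun _ => ?_
  · have : f (vq0 k) = f wi * f (vlami k) := by
      linear_combination f wi * f (vlami k) * map_vq0_mul f
        - f wi * f (vlami k) * f (vq0 k) * hq0i - f (vq0 k) * f w * f wi * hl - f (vq0 k) * hω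
    rw [this]
    exact S.mul_mem mwi mlami
  · rw [hq0i]
    exact S.mul_mem mw mlam
  · intro j h1 h2
    rcases Nat.eq_or_lt_of_le h2 with rfl | h3
    · rw [← evenHom_CCX f w wi]
      exact hE _
    · have := hC (baseVar (some (.inl ⟨j - 1, by omega⟩)))
      rw [baseRestrict, baseHom_inl] at this
      simpa only [Nat.sub_add_cancel h1] using this
  · intro j hj
    rcases Nat.eq_zero_or_pos j with rfl | h1
    · have : f (vA k 0) = 1 + f w * f (vlam k) - f w * f (vlami k) * evenHom f w wi X := by
        rw [evenHom_X, hq0i]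
        linear_combination (f w * f (vlam k) - (f (vA k 0) - 1)) *
          (f (vlam k) * f (vlami k) * hω + hl)
      rw [this]
      exact S.sub_mem (S.add_mem S.one_mem (S.mul_mem mw mlam))
        (S.mul_mem (S.mul_mem mw mlami) (hE _))
    · have := hC (baseVar (some (.inr ⟨j - 1, by omega⟩)))
      rw [baseRestrict, baseHom_inr] at this
      simpa only [Nat.sub_add_cancel h1] using this
  · have : f (midTail k (Qcv k) (vA k) - vA k (k / 2)) =
        -(f w * f (vlami k) * evenHom f w wi (C X)) := by
      rw [evenHom_CX]
      linear_combination (-f (midTail k (Qcv k) (vA k) - vA k (k / 2))) *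
        (f (vlam k) * f (vlami k) * hω + hl)
    rw [this]
    exact S.neg_mem (S.mul_mem (S.mul_mem mw mlami) (hE _))

theorem isDomain_even (hk1 : 1 ≤ k) (hk : k % 2 = 0) {w wi : Omega k}
    (hw : w = vq k ∧ wi = vqi k ∨ w = -vqi k ∧ wi = -vq k)
    {bs : Omega k} {f : Omega k →+* R} (hf : Function.Surjective f)
    (hker : RingHom.ker f = Isig k bs) (hbs : bs ∣ vq0i k - w * vlam k)
    (hbs' : vq0i k - w * vlam k ∣ bs) : IsDomain R ∧ f (w ^ 2 + 1) ≠ 0 := by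
  let φ := algebraMap ((BaseRing ((k - 1) / 2))[X]) (FractionRing ((BaseRing ((k - 1) / 2))[X]))
  have hφ : Function.Injective φ := IsFractionRing.injective _ _
  obtain ⟨Φ, t, b, ht, hb, hΦ⟩ := even_exists_hom hk1 hk hw hf hker hbs' φ hφ
  have hwi : w * wi = 1 ∧ vq k - vqi k = w - wi := by
    rcases hw with ⟨rfl, rfl⟩ | ⟨rfl, rfl⟩
    · exact ⟨vq_mul_vqi, rfl⟩
    · exact ⟨by linear_combination vq_mul_vqi (k := k), by ring⟩
  have hω : f w * f wi = 1 := by rw [← map_mul, hwi.1, map_one]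
  have hδ : f (vq k) - f (vqi k) = f w - f wi := by rw [← map_sub, hwi.2, map_sub]
  have hl := map_vlam_mul f
  have hq0i : f (vq0i k) = f w * f (vlam k) := by
    obtain ⟨c, hc⟩ := hbs
    have := congrArg f hc
    rw [map_mul, map_bs_eq_zero hker, zero_mul, map_sub, map_mul] at this
    exact sub_eq_zero.1 this
  have h0 := map_hO_zero_eq hker
  obtain ⟨hz, hz'⟩ := map_hO hker (by omega : 1 ≤ k / 2) le_rfl
  rw [hO, hElt_mid hk1 hk _ _ _ _ _ _ _ (Qcv_self hk1), map_add, map_mul, map_mul, map_mul,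
    map_add, map_one, map_sub f (vq k), hδ, hq0i] at hz
  rw [h'O, h'Elt_mid hk1 hk _ _ _ (Qcv_self hk1), map_sub, map_mul, map_mul, map_sub f (vq0i k),
    map_sub f (vA k 0 - 1), map_sub f (vA k 0), map_one, hq0i] at hz'
  rw [hδ] at h0
  have hinj : Function.Injective Φ := by
    refine injective_of_saturation _ _ (saturation_even hk1 hk hw hwi.1 hf hker hq0i) ?_ Φ <|
      eval_eq_zero_of_minors φ hφ t b (baseX ^ 2 - 1) (baseX * baseVar none - 1)
        (baseX * baseVar none + 1)
        (fun c => dvd_of_dvd_mul_base (by simp) (by simp))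
        (fun c => dvd_of_dvd_mul_base (by simp) (by simp))
        ht hb (evenHom f w wi) Φ hΦ ?_ ?_ ?_
    · rw [evenHom_CCC]
      simp only [baseRestrict, map_mul, baseHom_baseX, baseHom_none]
      exact (IsUnit.of_mul_eq_one _ hω).mul (IsUnit.of_mul_eq_one _ hl)
    · simp only [map_mul, map_sub, map_add, map_pow, map_one, evenHom_CCC, evenHom_CCX, evenHom_CX,
        baseRestrict, baseHom_baseX, baseHom_none]
      rw [map_sub] at hz
      linear_combination (-f (vlam k)) * hz
        - f w * f (vlam k) * (f (midTail k (Qcv k) (vA k)) - f (vA k (k / 2))) * hω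
        + (f w * f (vlam k) + 1) * f (Qcv k (k / 2)) * hl
    · rw [evenHom_C_mul_X_sub_C, hq0i]
      simp only [map_mul, map_sub, map_add, map_pow, map_one, evenHom_CCC, baseRestrict,
        baseHom_baseX, baseHom_none]
      linear_combination (-f (vlam k)) * h0 + (f w * f (vlam k) * (f w * f (vlam k)
        - f (vA k 0) + 1) - f (vlam k) ^ 2) * hω - hl
    · rw [evenHom_C_mul_X_sub_C, hq0i]
      simp only [map_mul, map_sub, map_one, evenHom_CCC, evenHom_CCX, evenHom_CX, baseRestrict,
        baseHom_baseX, baseHom_none]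
      rw [map_sub] at hz'
      linear_combination (f (vlam k) * f wi) * hz'
  refine ⟨hinj.isDomain Φ, fun h2 => ?_⟩
  have h3 : Φ (evenHom f w wi (C (C (C (baseX ^ 2 + 1))))) = φ (C (baseX ^ 2 + 1)) := by
    rw [← RingHom.comp_apply, hΦ, coe_eval₂RingHom, eval₂_C, coe_eval₂RingHom, eval₂_C]
  rw [evenHom_CCC, baseRestrict, map_add, map_pow, map_one, baseHom_baseX, ← map_pow, ← map_one f,
    ← map_add, h2, map_zero] at h3
  have h4 := congrArg (baseHom ((k - 1) / 2) (0 : ℤ) 0 0 0)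
    (C_eq_zero.1 ((map_eq_zero_iff φ hφ).1 h3.symm))
  simp at h4

end EvenComponent

section Components

variable {k : ℕ}

theorem isDomain_quotient_and_notMem {S : Type} [CommRing S] {I : Ideal S} {a : S}
    (h : ∀ {R : Type} [CommRing R] {f : S →+* R}, Function.Surjective f → RingHom.ker f = I →
      IsDomain R ∧ f a ≠ 0) : IsDomain (S ⧸ I) ∧ a ∉ I :=
  (h Ideal.Quotient.mk_surjective Ideal.mk_ker).imp id fun ha ha' =>
    ha (Ideal.Quotient.eq_zero_iff_mem.2 ha')

theorem isDomain_betaPl_odd (hk : k % 2 = 1) : IsDomain (Omega k ⧸ Isig k (betaPl k)) := by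
  rw [betaPl, if_pos hk]
  refine (isDomain_quotient_and_notMem fun hf hker => isDomain_odd hk (s := 1) (by norm_num) hf hker
    ⟨-vq0i k, ?_⟩ ⟨-vq0 k, ?_⟩).1 <;> push_cast
  · linear_combination vlam k * vq0_mul_vq0i (k := k)
  · linear_combination vq0_mul_vq0i (k := k)

theorem isDomain_betaMi_odd (hk : k % 2 = 1) :
    IsDomain (Omega k ⧸ Isig k (betaMi k)) ∧ (2 : Omega k) ∉ Isig k (betaMi k) := by
  rw [betaMi, if_pos hk]
  refine isDomain_quotient_and_notMem fun hf hker => isDomain_odd hk (s := -1) (by norm_num) hf hker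
    ⟨vlam k, ?_⟩ ⟨vlami k, ?_⟩ <;> push_cast
  · linear_combination (-vq0i k) * vlam_mul_vlami (k := k)
  · linear_combination -vlam_mul_vlami (k := k)

theorem isDomain_betaPl_even (hk1 : 1 ≤ k) (hk : k % 2 = 0) :
    IsDomain (Omega k ⧸ Isig k (betaPl k)) := by
  rw [betaPl, if_neg (by omega)]
  refine (isDomain_quotient_and_notMem fun hf hker =>
    isDomain_even hk1 hk (Or.inl ⟨rfl, rfl⟩) hf hker
      ⟨-(vq k * vq0i k), ?_⟩ ⟨-(vqi k * vq0 k), ?_⟩).1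
  · linear_combination vq k * vlam k * vq0_mul_vq0i (k := k) - vq0i k * vq_mul_vqi (k := k)
  · linear_combination vqi k * vq0_mul_vq0i (k := k) - vq0 k * vlam k * vq_mul_vqi (k := k)

theorem isDomain_betaMi_even (hk1 : 1 ≤ k) (hk : k % 2 = 0) :
    IsDomain (Omega k ⧸ Isig k (betaMi k)) ∧ (-vqi k) ^ 2 + 1 ∉ Isig k (betaMi k) := by
  rw [betaMi, if_neg (by omega)]
  refine isDomain_quotient_and_notMem fun hf hker =>
    isDomain_even hk1 hk (Or.inr ⟨rfl, rfl⟩) hf hker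
      ⟨vqi k * vlam k, ?_⟩ ⟨vq k * vlami k, ?_⟩
  · linear_combination (-(vq0i k * vlam k * vlami k)) * vq_mul_vqi (k := k)
      - vq0i k * vlam_mul_vlami (k := k)
  · linear_combination (-(vlam k * vlami k)) * vq_mul_vqi (k := k) - vlam_mul_vlami (k := k)

theorem isDomain_betaPl (hk : 1 ≤ k) : IsDomain (Omega k ⧸ Isig k (betaPl k)) := by
  rcases Nat.mod_two_eq_zero_or_one k with h | h
  exacts [isDomain_betaPl_even hk h, isDomain_betaPl_odd h]

theorem isDomain_betaMi (hk : 1 ≤ k) : IsDomain (Omega k ⧸ Isig k (betaMi k)) := by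
  rcases Nat.mod_two_eq_zero_or_one k with h | h
  exacts [(isDomain_betaMi_even hk h).1, (isDomain_betaMi_odd h).1]

theorem mem_Isig_self (bs : Omega k) : bs ∈ Isig k bs :=
  Ideal.subset_span (Or.inl (Or.inl rfl))

theorem betaPl_notMem (hk : 1 ≤ k) : betaPl k ∉ Isig k (betaMi k) := by
  intro hmem
  have hβ := mem_Isig_self (betaMi k)
  have e0 := vq0_mul_vq0i (k := k)
  have el := vlam_mul_vlami (k := k)
  have eq := vq_mul_vqi (k := k)
  rcases Nat.mod_two_eq_zero_or_one k with h | h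
  · refine (isDomain_betaMi_even hk h).2 ?_
    have e : (-vqi k) ^ 2 + 1 = vqi k * (vq0 k * vlam k * betaMi k) - vqi k * betaPl k := by
      rw [betaMi, betaPl, if_neg (by omega), if_neg (by omega)]
      linear_combination (-(vq0 k * vq0i k * vlam k * vlami k)) * eq - vlam k * vlami k * e0 - el
    rw [e]
    exact Ideal.sub_mem _ (Ideal.mul_mem_left _ _ (Ideal.mul_mem_left _ _ hβ))
      (Ideal.mul_mem_left _ _ hmem)
  · refine (isDomain_betaMi_odd h).2 ?_
    have e : (2 : Omega k) = vq0 k * vlam k * betaMi k - betaPl k := by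
      rw [betaMi, betaPl, if_pos h, if_pos h]
      linear_combination (-(vlam k * vlami k)) * e0 - el
    rw [e]
    exact Ideal.sub_mem _ (Ideal.mul_mem_left _ _ hβ) hmem

theorem betaO_eq : betaO k = betaPl k * betaMi k := by
  have e0 := vq0_mul_vq0i (k := k)
  have el := vlam_mul_vlami (k := k)
  have eq := vq_mul_vqi (k := k)
  rcases Nat.mod_two_eq_zero_or_one k with h | h
  · rw [betaO, betaElt, betaMi, betaPl, if_neg (by omega), if_neg (by omega),
      show 1 - (2 * ((k + 1) / 2) - k) = 1 by omega, Nat.cast_one]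
    linear_combination vq0i k * vlami k * eq - vq k * vlam k * vlami k * e0 - vq k * el
  · rw [betaO, betaElt, betaMi, betaPl, if_pos h, if_pos h,
      show 1 - (2 * ((k + 1) / 2) - k) = 0 by omega, Nat.cast_zero]
    linear_combination (-(vlam k * vlami k)) * e0 - el

theorem Isig_eq_sup (bs : Omega k) : Isig k bs = Ideal.span {bs} ⊔
    Ideal.span ({hO k 0} ∪ {x | ∃ l, 1 ≤ l ∧ l ≤ k / 2 ∧ (x = hO k l ∨ x = h'O k l)}) := by
  rw [← Ideal.span_union, Isig, Set.insert_eq, Set.union_assoc]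

end Components

section Intersection

variable {S : Type*} [CommRing S]

theorem span_mul_sup_eq_inf {a b : S} {J : Ideal S} (hb : (Ideal.span {b} ⊔ J).IsPrime)
    (ha : a ∉ Ideal.span {b} ⊔ J) :
    Ideal.span {a * b} ⊔ J = (Ideal.span {a} ⊔ J) ⊓ (Ideal.span {b} ⊔ J) := by
  refine le_antisymm (le_inf ?_ ?_) fun x hx => ?_
  · exact sup_le_sup_right (Ideal.span_singleton_le_span_singleton.2 (dvd_mul_right a b)) J
  · exact sup_le_sup_right (Ideal.span_singleton_le_span_singleton.2 (dvd_mul_left b a)) J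
  · obtain ⟨hxa, hxb⟩ := hx
    obtain ⟨y, j, hj, rfl⟩ := Ideal.mem_span_singleton_sup.1 hxa
    have hy := (hb.mem_or_mem <| (Ideal.add_mem_iff_left _
      (le_sup_right (a := Ideal.span {b}) hj)).1 hxb).resolve_right ha
    obtain ⟨z, i, hi, rfl⟩ := Ideal.mem_span_singleton_sup.1 hy
    exact Ideal.mem_span_singleton_sup.2
      ⟨z, i * a + j, J.add_mem (J.mul_mem_right a hi) hj, by ring⟩

end Intersection

/-- Lemma 14(c),(d) of the paper. (c) `R₊ = Ω/I₊` and `R₋ = Ω/I₋` are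
integral domains; (d) `I₀ = I₊ ∩ I₋`. -/
theorem statement17 (k : ℕ) (hk : 1 ≤ k) :
    (IsDomain (Omega k ⧸ Isig k (betaPl k)) ∧ IsDomain (Omega k ⧸ Isig k (betaMi k))) ∧
    Isig k (betaO k) = Isig k (betaPl k) ⊓ Isig k (betaMi k) := by
  refine ⟨⟨isDomain_betaPl hk, isDomain_betaMi hk⟩, ?_⟩
  have hp : (Isig k (betaMi k)).IsPrime :=
    (Ideal.Quotient.isDomain_iff_prime _).1 (isDomain_betaMi hk)
  have hn := betaPl_notMem hk
  rw [Isig_eq_sup] at hp hn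
  rw [betaO_eq, Isig_eq_sup, Isig_eq_sup, Isig_eq_sup]
  exact span_mul_sup_eq_inf hp hn
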